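/- arXiv:2502.08433 — 2 statements merged into one kernel-verified Lean document; each statement's English description precedes it below -/
import Mathlib

section
/- (Proposition 6) Let α ∈ ℂ with 0 < Re α ≤ 1/2, let (φ₁, φ₂) be an admissible weight pair, and let ε, η satisfy 0 < ε < Re α and 1 − Re α < η < 1. Then for every f ∈ B_{ε,η}, the integral (R₂₃^{α} f)(x) = ∫₀^∞ R₂₃(x,y;α)·f(y) dy converges absolutely for every x > 0 and R₂₃^{α} f ∈ B_{ε,η}. -/
open MeasureTheory Set Asymptotics

noncomputable section

/-- `r₁(x;α)` from Dixon's resolvent kernels. -/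
def r1 (α : ℂ) (x : ℝ) : ℂ :=
  if α = -(1/2 : ℂ) then
    -(2 / (Real.pi : ℂ)) * ((x : ℂ) ^ ((1 : ℂ)/2) * (Real.log x : ℂ)) / (1 - (x : ℂ) ^ 2)
  else
    (1 / Complex.cos ((Real.pi : ℂ) * α)) *
      (((x : ℂ) ^ (-α) - (x : ℂ) ^ (α + 1)) / (1 - (x : ℂ) ^ 2))

def r2 (α : ℂ) (x : ℝ) : ℂ := -(1 / (x : ℂ)) * r1 (-α) x

def r3 (α : ℂ) (x : ℝ) : ℂ := (x : ℂ) ^ 2 * r2 α x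

def R1 (α : ℂ) (x y : ℝ) : ℂ := (1 / (y : ℂ)) * r1 α (x / y)
def R2 (α : ℂ) (x y : ℝ) : ℂ := (1 / (y : ℂ)) * r2 α (x / y)
def R3 (α : ℂ) (x y : ℝ) : ℂ := (1 / (y : ℂ)) * r3 α (x / y)

/-- membership in `E`: integrable on `(0,∞)` with weight `1/(1+x)`. -/
def MemE (f : ℝ → ℂ) : Prop :=
  IntegrableOn (fun x : ℝ => f x / (1 + (x : ℂ))) (Ioi 0)

/-- membership in `E_k`: integrable on `(0,∞)` with weight `x^{k-1}`. -/
def MemEk (k : ℝ) (f : ℝ → ℂ) : Prop :=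
  IntegrableOn (fun x : ℝ => (x ^ (k - 1) : ℝ) • f x) (Ioi 0)

/-- membership in `B_{ε,η}`. -/
def MemB (ε η : ℝ) (f : ℝ → ℂ) : Prop :=
  ContinuousOn f (Ioi 0) ∧
  ∃ M : ℝ, (∀ x : ℝ, 1 < x → x ^ ε * ‖f x‖ ≤ M) ∧ (∀ x : ℝ, 0 < x → x < 1 → x ^ η * ‖f x‖ ≤ M)

/-- the norm of `B_{ε,η}`. -/
def Bnorm (ε η : ℝ) (f : ℝ → ℂ) : ℝ :=
  sSup ((fun x : ℝ => x ^ ε * ‖f x‖) '' Ioi 1) + sSup ((fun x : ℝ => x ^ η * ‖f x‖) '' Ioo 0 1)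

/-- admissible weight pair `(φ₁,φ₂)`. -/
def AdmissiblePair (φ₁ φ₂ : ℝ → ℝ) : Prop :=
  ContinuousOn φ₁ (Ioi 0) ∧ ContinuousOn φ₂ (Ioi 0) ∧
  (∀ y : ℝ, 0 < y → (φ₁ y ∈ Ioo (0:ℝ) 1 ∧ φ₂ y ∈ Ioo (0:ℝ) 1 ∧ φ₁ y + φ₂ y = 1)) ∧
  φ₁ =O[Filter.atTop] (fun y : ℝ => 1 / y) ∧
  (fun y : ℝ => φ₁ y - 1) =O[nhdsWithin 0 (Ioi 0)] (fun y : ℝ => y)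

/-- the combined kernel `R₂₃`. -/
def R23 (φ₁ φ₂ : ℝ → ℝ) (α : ℂ) (x y : ℝ) : ℂ :=
  (φ₁ y : ℂ) * R2 α x y + (φ₂ y : ℂ) * R3 α x y


theorem aestronglyMeasurable_of_mellinConvergent {k : ℝ → ℂ} {s : ℂ}
    (hk : MellinConvergent k s) : AEStronglyMeasurable k (volume.restrict (Ioi 0)) := by
  have hpow : AEStronglyMeasurable (fun t : ℝ => (t : ℂ) ^ (-(s - 1)))
      (volume.restrict (Ioi 0)) :=
    (Measurable.pow_const Complex.measurable_ofReal _).aestronglyMeasurable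
  refine (hpow.mul hk.aestronglyMeasurable).congr ?_
  filter_upwards [ae_restrict_mem measurableSet_Ioi] with t ht
  have ht' : (t : ℂ) ≠ 0 := Complex.ofReal_ne_zero.2 (ne_of_gt ht)
  simp only [Pi.mul_apply, smul_eq_mul, ← mul_assoc]
  rw [← Complex.cpow_add _ _ ht', neg_add_cancel, Complex.cpow_zero, one_mul]

/-- A multiplicative convolution on `(0,∞)` against a kernel with convergent Mellin transform
maps continuous functions that are `O(y ^ (-p))` to functions of the same kind. -/
theorem mulConvolution_of_mellinConvergent {k g : ℝ → ℂ} {p C : ℝ}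
    (hk : MellinConvergent k ((1 - p : ℝ) : ℂ)) (hg : ContinuousOn g (Ioi 0))
    (hC : ∀ y, 0 < y → ‖g y‖ ≤ C * y ^ (-p)) :
    (∀ x : ℝ, 0 < x → IntegrableOn (fun y : ℝ => (x : ℂ)⁻¹ * k (y / x) * g y) (Ioi 0)) ∧
    ContinuousOn (fun x : ℝ => ∫ y in Ioi (0 : ℝ), (x : ℂ)⁻¹ * k (y / x) * g y) (Ioi 0) ∧
    ∃ D : ℝ, ∀ x : ℝ, 0 < x →
      ‖∫ y in Ioi (0 : ℝ), (x : ℂ)⁻¹ * k (y / x) * g y‖ ≤ D * x ^ (-p) := by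
  have hkm := aestronglyMeasurable_of_mellinConvergent hk
  have hkn : IntegrableOn (fun t : ℝ => t ^ (-p) * ‖k t‖) (Ioi 0) := by
    have h := (mellin_convergent_iff_norm subset_rfl measurableSet_Ioi hkm).1 hk
    simpa [show (1 - p - 1 : ℝ) = -p by ring] using h
  have hC0 : 0 ≤ C := by simpa using (norm_nonneg _).trans (hC 1 one_pos)
  have hmeas : ∀ x : ℝ, 0 < x →
      AEStronglyMeasurable (fun t => k t * g (x * t)) (volume.restrict (Ioi 0)) := by
    intro x hx
    refine hkm.mul (ContinuousOn.aestronglyMeasurable ?_ measurableSet_Ioi)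
    exact hg.comp (by fun_prop) fun t ht => mul_pos hx ht
  have hbound : ∀ x : ℝ, 0 < x → ∀ t : ℝ, 0 < t →
      ‖k t * g (x * t)‖ ≤ C * x ^ (-p) * (t ^ (-p) * ‖k t‖) := by
    intro x hx t ht
    have h := hC (x * t) (mul_pos hx ht)
    rw [Real.mul_rpow hx.le ht.le] at h
    rw [norm_mul]
    calc ‖k t‖ * ‖g (x * t)‖ ≤ ‖k t‖ * (C * (x ^ (-p) * t ^ (-p))) := by gcongr
      _ = _ := by ring
  have hint : ∀ x : ℝ, 0 < x → IntegrableOn (fun t => k t * g (x * t)) (Ioi 0) := by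
    intro x hx
    refine Integrable.mono' (hkn.const_mul (C * x ^ (-p))) (hmeas x hx) ?_
    filter_upwards [ae_restrict_mem measurableSet_Ioi] with t ht using hbound x hx t ht
  have hsubst : ∀ x : ℝ, 0 < x → (fun y : ℝ => (x : ℂ)⁻¹ * k (y / x) * g y) =
      fun y => (x : ℂ)⁻¹ * (fun t => k t * g (x * t)) (x⁻¹ * y) := by
    intro x hx
    funext y
    simp only [mul_inv_cancel_left₀ hx.ne', div_eq_inv_mul, mul_assoc]
  have hval : ∀ x : ℝ, 0 < x → ∫ y in Ioi (0 : ℝ), (x : ℂ)⁻¹ * k (y / x) * g y =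
      ∫ t in Ioi (0 : ℝ), k t * g (x * t) := by
    intro x hx
    have hx' : (x : ℂ) ≠ 0 := Complex.ofReal_ne_zero.2 hx.ne'
    rw [hsubst x hx, integral_const_mul,
      integral_comp_mul_left_Ioi (fun t => k t * g (x * t)) 0 (inv_pos.2 hx)]
    simp [hx']
  refine ⟨fun x hx => ?_, ?_, C * ∫ t in Ioi (0 : ℝ), t ^ (-p) * ‖k t‖, fun x hx => ?_⟩
  · rw [hsubst x hx]
    refine Integrable.const_mul ?_ _
    have := (integrableOn_Ioi_comp_mul_left_iff (fun t => k t * g (x * t)) 0 (inv_pos.2 hx)).2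
    simp only [mul_zero] at this
    exact this (hint x hx)
  · refine ContinuousOn.congr (f := fun x => ∫ t in Ioi (0 : ℝ), k t * g (x * t)) ?_ hval
    intro x hx
    have hx0 : 0 < x := hx
    refine ContinuousAt.continuousWithinAt ?_
    have hpow : ∀ᶠ z : ℝ in nhds x, z ^ (-p) < x ^ (-p) + 1 :=
      (Real.continuousAt_rpow_const x (-p) (Or.inl hx0.ne')).eventually_lt_const (lt_add_one _)
    refine continuousAt_of_dominated
      (bound := fun t => C * (x ^ (-p) + 1) * (t ^ (-p) * ‖k t‖)) ?_ ?_ (hkn.const_mul _) ?_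
    · filter_upwards [Ioi_mem_nhds hx0] with z hz using hmeas z hz
    · filter_upwards [Ioi_mem_nhds hx0, hpow] with z hz hzp
      filter_upwards [ae_restrict_mem measurableSet_Ioi] with t ht
      have ht0 : (0 : ℝ) < t := ht
      refine (hbound z hz t ht).trans ?_
      gcongr
    · filter_upwards [ae_restrict_mem measurableSet_Ioi] with t ht
      have hcg : ContinuousAt g (x * t) := hg.continuousAt (Ioi_mem_nhds (mul_pos hx0 ht))
      exact continuousAt_const.mul (ContinuousAt.comp' hcg (by fun_prop))
  · rw [hval x hx]
    calc ‖∫ t in Ioi (0 : ℝ), k t * g (x * t)‖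
        ≤ ∫ t in Ioi (0 : ℝ), C * x ^ (-p) * (t ^ (-p) * ‖k t‖) := by
          refine norm_integral_le_of_norm_le (hkn.const_mul _) ?_
          filter_upwards [ae_restrict_mem measurableSet_Ioi] with t ht using hbound x hx t ht
      _ = _ := by rw [integral_const_mul]; ring

/-- Mellin convergence of a quotient by `1 - s ^ 2` whose numerator vanishes at `1`. -/
theorem mellinConvergent_div_one_sub_sq {N : ℝ → ℂ} {b : ℝ} {σ : ℂ}
    (hcont : ContinuousOn N (Ioi 0)) (hdiff : DifferentiableAt ℝ N 1) (hN1 : N 1 = 0)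
    (hzero : N =O[nhdsWithin 0 (Ioi 0)] fun s : ℝ => s ^ b)
    (htop : N =O[Filter.atTop] fun s : ℝ => s ^ (1 - b))
    (hσ1 : -b < σ.re) (hσ2 : σ.re < 1 + b) :
    MellinConvergent (fun s : ℝ => N s / (1 - (s : ℂ) ^ 2)) σ := by
  have hden : Continuous fun s : ℝ => (1 - (s : ℂ) ^ 2) := by fun_prop
  have hmeas : AEStronglyMeasurable (fun s : ℝ => N s / (1 - (s : ℂ) ^ 2))
      (volume.restrict (Ioi 0)) :=
    ((hcont.aestronglyMeasurable measurableSet_Ioi).aemeasurable.div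
      hden.measurable.aemeasurable).aestronglyMeasurable
  refine mellinConvergent_of_isBigO_rpow (a := 1 + b) (b := -b) ?_ ?_ hσ2 ?_ hσ1
  · intro x hx
    have hx0 : (0 : ℝ) < x := hx
    rcases eq_or_ne x 1 with rfl | hx1
    · refine Measure.FiniteAtFilter.integrableAtFilter
        ⟨Ioi 0, self_mem_nhdsWithin, hmeas⟩
        (volume.finiteAt_nhdsWithin 1 (Ioi 0)) ?_
      have hN : N =O[nhds 1] fun s : ℝ => s - 1 := by
        simpa [hN1] using hdiff.hasDerivAt.isBigO_sub
      obtain ⟨c, hc⟩ := (hN.mono nhdsWithin_le_nhds :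
        N =O[nhdsWithin 1 (Ioi 0)] fun s : ℝ => s - 1).bound
      refine Filter.isBoundedUnder_of_eventually_le (a := |c|) ?_
      filter_upwards [hc, self_mem_nhdsWithin] with s hs hs0
      have hs0' : (0 : ℝ) < s := hs0
      have hfac : ‖1 - (s : ℂ) ^ 2‖ = |s - 1| * (1 + s) := by
        rw [show (1 - (s : ℂ) ^ 2) = ((1 - s ^ 2 : ℝ) : ℂ) by push_cast; ring,
          Complex.norm_real, Real.norm_eq_abs, show 1 - s ^ 2 = -((s - 1) * (1 + s)) by ring,
          abs_neg, abs_mul, abs_of_pos (show 0 < 1 + s by linarith)]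
      rw [Function.comp_apply, norm_div, hfac]
      refine div_le_of_le_mul₀ (by positivity) (abs_nonneg _) ?_
      rw [Real.norm_eq_abs] at hs
      calc ‖N s‖ ≤ c * |s - 1| := hs
        _ ≤ |c| * |s - 1| := by gcongr; exact le_abs_self c
        _ ≤ |c| * (|s - 1| * (1 + s)) := by
          gcongr
          exact le_mul_of_one_le_right (abs_nonneg _) (by linarith)
    · refine Measure.FiniteAtFilter.integrableAtFilter
        ⟨Ioi 0, self_mem_nhdsWithin, hmeas⟩
        (volume.finiteAt_nhdsWithin x (Ioi 0)) ?_
      have hne : (1 - (x : ℂ) ^ 2) ≠ 0 := by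
        have : (1 - x ^ 2 : ℝ) ≠ 0 := by
          intro h
          exact hx1 (by nlinarith)
        exact_mod_cast this
      have hc := ((hcont x hx).div hden.continuousWithinAt hne).norm
      exact hc.isBoundedUnder_le
  · have hd : (fun s : ℝ => (1 - (s : ℂ) ^ 2)⁻¹) =O[Filter.atTop] fun s : ℝ => s ^ (-2 : ℝ) := by
      refine IsBigO.of_bound 2 ?_
      filter_upwards [Filter.eventually_ge_atTop (2 : ℝ)] with s hs
      have hs0 : 0 < s := by linarith
      have h1 : ‖1 - (s : ℂ) ^ 2‖ = s ^ 2 - 1 := by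
        rw [show (1 - (s : ℂ) ^ 2) = ((1 - s ^ 2 : ℝ) : ℂ) by push_cast; ring,
          Complex.norm_real, Real.norm_eq_abs, abs_of_neg (by nlinarith)]
        ring
      rw [norm_inv, h1, Real.rpow_neg hs0.le, Real.rpow_two, Real.norm_of_nonneg (by positivity),
        ← div_eq_mul_inv, inv_eq_one_div, div_le_div_iff₀ (by nlinarith) (by positivity)]
      nlinarith
    refine (htop.mul hd).congr' (Filter.Eventually.of_forall fun s => (div_eq_mul_inv _ _).symm) ?_
    filter_upwards [Filter.eventually_gt_atTop (0 : ℝ)] with s hs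
    rw [← Real.rpow_add hs]
    congr 1
    ring
  · have hd : (fun s : ℝ => (1 - (s : ℂ) ^ 2)⁻¹) =O[nhdsWithin 0 (Ioi 0)] fun _ => (1 : ℝ) := by
      have h : ContinuousAt (fun s : ℝ => (1 - (s : ℂ) ^ 2)⁻¹) 0 :=
        hden.continuousAt.inv₀ (by simp)
      exact (h.mono_left nhdsWithin_le_nhds).isBigO_one ℝ
    simpa [div_eq_mul_inv] using hzero.mul hd

theorem isBigO_ofReal_cpow_atTop (z : ℂ) {c : ℝ} (hc : z.re ≤ c) :
    (fun s : ℝ => (s : ℂ) ^ z) =O[Filter.atTop] fun s : ℝ => s ^ c := by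
  refine IsBigO.of_bound 1 ?_
  filter_upwards [Filter.eventually_ge_atTop (1 : ℝ)] with s hs
  have hs0 : 0 < s := by linarith
  rw [Complex.norm_cpow_eq_rpow_re_of_pos hs0, Real.norm_of_nonneg (by positivity), one_mul]
  exact Real.rpow_le_rpow_of_exponent_le hs hc

theorem isBigO_ofReal_cpow_zero (z : ℂ) {c : ℝ} (hc : c ≤ z.re) :
    (fun s : ℝ => (s : ℂ) ^ z) =O[nhdsWithin 0 (Ioi 0)] fun s : ℝ => s ^ c := by
  refine IsBigO.of_bound 1 ?_
  filter_upwards [Ioo_mem_nhdsGT one_pos] with s hs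
  rw [Complex.norm_cpow_eq_rpow_re_of_pos hs.1, Real.norm_of_nonneg (Real.rpow_nonneg hs.1.le _),
    one_mul]
  exact Real.rpow_le_rpow_of_exponent_ge hs.1 hs.2.le hc

theorem continuousOn_ofReal_cpow_const (z : ℂ) :
    ContinuousOn (fun s : ℝ => (s : ℂ) ^ z) (Ioi 0) := fun s hs =>
  (Complex.continuousAt_ofReal_cpow_const s z (Or.inr (ne_of_gt hs))).continuousWithinAt

theorem differentiableAt_ofReal_cpow_const_one (z : ℂ) :
    DifferentiableAt ℝ (fun s : ℝ => (s : ℂ) ^ z) 1 :=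
  (((hasDerivAt_id (1 : ℂ)).cpow_const (c := z) (by simp)).comp_ofReal
    (z := 1)).differentiableAt

theorem mellinConvergent_r1_neg {α σ : ℂ} (hα2 : α.re ≤ 1 / 2)
    (hσ1 : -α.re < σ.re) (hσ2 : σ.re < 1 + α.re) : MellinConvergent (r1 (-α)) σ := by
  by_cases hα : -α = -(1 / 2 : ℂ)
  · have hre : α.re = 1 / 2 := by
      rw [neg_injective hα]
      norm_num
    obtain ⟨b, hb1, hb2⟩ : ∃ b, max (-σ.re) (σ.re - 1) < b ∧ b < (1 / 2 : ℝ) :=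
      exists_between (max_lt (by linarith) (by linarith))
    rw [max_lt_iff] at hb1
    have hlog : ∀ {l : Filter ℝ} {c : ℝ}, (Real.log =O[l] fun s : ℝ => s ^ c) →
        (fun s : ℝ => (Real.log s : ℂ)) =O[l] fun s : ℝ => s ^ c := fun h =>
      (isBigO_norm_left (f' := fun s : ℝ => (Real.log s : ℂ))).1
        (by simpa using h.norm_left)
    have key := mellinConvergent_div_one_sub_sq (b := b) (σ := σ)
      (N := fun s : ℝ => (s : ℂ) ^ ((1 : ℂ) / 2) * (Real.log s : ℂ)) ?_ ?_ (by simp) ?_ ?_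
      (by linarith) (by linarith)
    · convert key.const_smul (-(2 / (Real.pi : ℂ))) using 2 with s
      rw [r1, if_pos hα, smul_eq_mul, mul_div_assoc]
    · refine (continuousOn_ofReal_cpow_const _).mul
        (Complex.continuous_ofReal.comp_continuousOn (Real.continuousOn_log.mono ?_))
      intro s hs
      exact ne_of_gt hs
    · exact (differentiableAt_ofReal_cpow_const_one _).mul
        (Real.hasDerivAt_log one_ne_zero).ofReal_comp.differentiableAt
    · have h := (isBigO_ofReal_cpow_zero ((1 : ℂ) / 2) (c := 1 / 2) (by norm_num)).mul
        (hlog (isLittleO_log_rpow_nhdsGT_zero (r := b - 1 / 2) (by linarith)).isBigO)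
      refine h.congr' .rfl ?_
      filter_upwards [self_mem_nhdsWithin] with s hs
      rw [← Real.rpow_add hs]
      congr 1
      ring
    · have h := (isBigO_ofReal_cpow_atTop ((1 : ℂ) / 2) (c := 1 / 2) (by norm_num)).mul
        (hlog (isLittleO_log_rpow_atTop (r := 1 / 2 - b) (by linarith)).isBigO)
      refine h.congr' .rfl ?_
      filter_upwards [Filter.eventually_gt_atTop (0 : ℝ)] with s hs
      rw [← Real.rpow_add hs]
      congr 1
      ring
  · have key := mellinConvergent_div_one_sub_sq (b := α.re) (σ := σ)
      (N := fun s : ℝ => (s : ℂ) ^ (- -α) - (s : ℂ) ^ (-α + 1))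
      ((continuousOn_ofReal_cpow_const _).sub (continuousOn_ofReal_cpow_const _))
      ((differentiableAt_ofReal_cpow_const_one _).sub (differentiableAt_ofReal_cpow_const_one _))
      (by simp)
      ((isBigO_ofReal_cpow_zero _ (by simp)).sub
        (isBigO_ofReal_cpow_zero _ (by simp; linarith)))
      ((isBigO_ofReal_cpow_atTop _ (by simp; linarith)).sub
        (isBigO_ofReal_cpow_atTop _ (by simp [add_comm, sub_eq_add_neg])))
      hσ1 hσ2
    convert key.const_smul (1 / Complex.cos ((Real.pi : ℂ) * -α)) using 2 with s
    rw [r1, if_neg hα, smul_eq_mul]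

theorem mellinConvergent_comp_inv {f : ℝ → ℂ} {s : ℂ} (hf : MellinConvergent f (-s)) :
    MellinConvergent (fun t => f t⁻¹) s := by
  simp_rw [← Real.rpow_neg_one]
  rw [MellinConvergent.comp_rpow (by norm_num)]
  simpa [div_neg] using hf

theorem AdmissiblePair.exists_fst_le {φ₁ φ₂ : ℝ → ℝ} (h : AdmissiblePair φ₁ φ₂) :
    ∃ c : ℝ, 1 ≤ c ∧ ∀ y, 0 < y → φ₁ y ≤ c / y := by
  obtain ⟨-, -, hmem, htop, -⟩ := h
  obtain ⟨c, hc⟩ := htop.bound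
  obtain ⟨Y, hY⟩ := Filter.eventually_atTop.1 hc
  refine ⟨max 1 (max c Y), le_max_left _ _, fun y hy => ?_⟩
  rcases le_total Y y with h | h
  · have h1 := hY y h
    rw [Real.norm_eq_abs, Real.norm_of_nonneg (by positivity), mul_one_div] at h1
    refine (le_abs_self _).trans (h1.trans ?_)
    gcongr
    exact (le_max_left _ _).trans (le_max_right _ _)
  · refine (hmem y hy).1.2.le.trans ?_
    rw [one_le_div hy]
    exact h.trans ((le_max_right _ _).trans (le_max_right _ _))

theorem AdmissiblePair.exists_snd_le {φ₁ φ₂ : ℝ → ℝ} (h : AdmissiblePair φ₁ φ₂) :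
    ∃ c : ℝ, 1 ≤ c ∧ ∀ y, 0 < y → φ₂ y ≤ c * y := by
  obtain ⟨-, -, hmem, -, hzero⟩ := h
  obtain ⟨c, hc⟩ := hzero.bound
  obtain ⟨δ, hδ, hδc⟩ := mem_nhdsGT_iff_exists_Ioo_subset.1 hc
  have hδ0 : (0 : ℝ) < δ := hδ
  refine ⟨max 1 (max c δ⁻¹), le_max_left _ _, fun y hy => ?_⟩
  rcases lt_or_ge y δ with h | h
  · have h1 : ‖φ₁ y - 1‖ ≤ c * ‖y‖ := hδc ⟨hy, h⟩
    have h2 : φ₂ y = -(φ₁ y - 1) := by linarith [(hmem y hy).2.2]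
    rw [Real.norm_eq_abs, Real.norm_of_nonneg hy.le] at h1
    rw [h2]
    refine (neg_le_abs _).trans (h1.trans ?_)
    gcongr
    exact (le_max_left _ _).trans (le_max_right _ _)
  · refine (hmem y hy).2.1.2.le.trans ?_
    calc (1 : ℝ) = δ⁻¹ * δ := (inv_mul_cancel₀ hδ0.ne').symm
      _ ≤ max 1 (max c δ⁻¹) * y := by
        gcongr
        exact (le_max_right _ _).trans (le_max_right _ _)

theorem MemB.exists_norm_le {ε η : ℝ} {f : ℝ → ℂ} (hf : MemB ε η f) :
    ∃ M : ℝ, 0 ≤ M ∧ (∀ y, 1 ≤ y → ‖f y‖ ≤ M * y ^ (-ε)) ∧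
      ∀ y, 0 < y → y ≤ 1 → ‖f y‖ ≤ M * y ^ (-η) := by
  obtain ⟨-, M, h1, h2⟩ := hf
  have hle : ∀ {p y : ℝ}, 0 < y → y ^ p * ‖f y‖ ≤ M →
      ‖f y‖ ≤ max M ‖f 1‖ * y ^ (-p) := by
    intro p y hy h
    rw [Real.rpow_neg hy.le, ← div_eq_mul_inv, le_div_iff₀ (Real.rpow_pos_of_pos hy p), mul_comm]
    exact h.trans (le_max_left _ _)
  refine ⟨max M ‖f 1‖, (norm_nonneg _).trans (le_max_right _ _), fun y hy => ?_,
    fun y hy0 hy => ?_⟩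
  · rcases hy.eq_or_lt with rfl | hy
    · simp
    · exact hle (one_pos.trans hy) (h1 y hy)
  · rcases hy.eq_or_lt with rfl | hy
    · simp
    · exact hle hy0 (h2 y hy0 hy)

theorem MemB.of_norm_le {ε η C D : ℝ} (hεη : ε ≤ η) {f g : ℝ → ℂ}
    (hf : ContinuousOn f (Ioi 0)) (hg : ContinuousOn g (Ioi 0))
    (hC : ∀ x, 0 < x → ‖f x‖ ≤ C * x ^ (-η)) (hD : ∀ x, 0 < x → ‖g x‖ ≤ D * x ^ (-ε)) :
    MemB ε η fun x => f x + g x := by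
  have hC0 : 0 ≤ C := by simpa using (norm_nonneg _).trans (hC 1 one_pos)
  have hD0 : 0 ≤ D := by simpa using (norm_nonneg _).trans (hD 1 one_pos)
  have hsum : ∀ {x p : ℝ}, 0 < x → x ^ (-η) ≤ x ^ (-p) → x ^ (-ε) ≤ x ^ (-p) →
      x ^ p * ‖f x + g x‖ ≤ C + D := by
    intro x p hx h1 h2
    rw [mul_comm, ← le_div_iff₀ (Real.rpow_pos_of_pos hx p), div_eq_mul_inv,
      ← Real.rpow_neg hx.le]
    calc ‖f x + g x‖ ≤ C * x ^ (-η) + D * x ^ (-ε) :=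
          (norm_add_le _ _).trans (add_le_add (hC x hx) (hD x hx))
      _ ≤ C * x ^ (-p) + D * x ^ (-p) := by gcongr
      _ = _ := by ring
  refine ⟨hf.add hg, C + D, fun x hx => ?_, fun x hx0 hx => ?_⟩
  · exact hsum (one_pos.trans hx)
      (Real.rpow_le_rpow_of_exponent_le hx.le (by linarith)) le_rfl
  · exact hsum hx0 le_rfl (Real.rpow_le_rpow_of_exponent_ge hx0 hx.le (by linarith))

theorem norm_fst_mul_le {φ₁ φ₂ : ℝ → ℝ} (hφ : AdmissiblePair φ₁ φ₂) {ε η : ℝ} (hε : 0 < ε)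
    (hη : η < 1) {f : ℝ → ℂ} (hf : MemB ε η f) :
    ∃ C : ℝ, ∀ y, 0 < y → ‖(φ₁ y : ℂ) * f y‖ ≤ C * y ^ (-η) := by
  obtain ⟨c, hc1, hc⟩ := hφ.exists_fst_le
  obtain ⟨M, hM, htop, hzero⟩ := hf.exists_norm_le
  refine ⟨c * M, fun y hy => ?_⟩
  have hφy := (hφ.2.2.1 y hy).1
  rw [norm_mul, Complex.norm_real, Real.norm_of_nonneg hφy.1.le, mul_assoc]
  rcases le_total y 1 with h | h
  · exact mul_le_mul (hφy.2.le.trans hc1) (hzero y hy h) (norm_nonneg _) (by linarith)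
  · calc φ₁ y * ‖f y‖ ≤ c / y * (M * y ^ (-ε)) :=
          mul_le_mul (hc y hy) (htop y h) (norm_nonneg _) (by positivity)
      _ = c * (M * y ^ (-1 - ε)) := by
          rw [sub_eq_add_neg, Real.rpow_add hy, Real.rpow_neg_one]
          ring
      _ ≤ c * (M * y ^ (-η)) := by
          have := Real.rpow_le_rpow_of_exponent_le h (show -1 - ε ≤ -η by linarith)
          gcongr

theorem norm_snd_mul_le {φ₁ φ₂ : ℝ → ℝ} (hφ : AdmissiblePair φ₁ φ₂) {ε η : ℝ} (hε : 0 < ε)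
    (hη : η < 1) {f : ℝ → ℂ} (hf : MemB ε η f) :
    ∃ C : ℝ, ∀ y, 0 < y → ‖(φ₂ y : ℂ) * f y‖ ≤ C * y ^ (-ε) := by
  obtain ⟨c, hc1, hc⟩ := hφ.exists_snd_le
  obtain ⟨M, hM, htop, hzero⟩ := hf.exists_norm_le
  refine ⟨c * M, fun y hy => ?_⟩
  have hφy := (hφ.2.2.1 y hy).2.1
  rw [norm_mul, Complex.norm_real, Real.norm_of_nonneg hφy.1.le, mul_assoc]
  rcases le_total y 1 with h | h
  · calc φ₂ y * ‖f y‖ ≤ c * y * (M * y ^ (-η)) :=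
          mul_le_mul (hc y hy) (hzero y hy h) (norm_nonneg _) (by positivity)
      _ = c * (M * y ^ (1 - η)) := by
          rw [sub_eq_add_neg, Real.rpow_add hy, Real.rpow_one]
          ring
      _ ≤ c * (M * y ^ (-ε)) := by
          have := Real.rpow_le_rpow_of_exponent_ge hy h (show -ε ≤ 1 - η by linarith)
          gcongr
  · exact mul_le_mul (hφy.2.le.trans hc1) (htop y h) (norm_nonneg _) (by linarith)

theorem R2_eq_mulConvolution_kernel (α : ℂ) {x y : ℝ} (hx : 0 < x) (hy : 0 < y) :
    R2 α x y = (x : ℂ)⁻¹ * -r1 (-α) (y / x)⁻¹ := by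
  have hx' : (x : ℂ) ≠ 0 := Complex.ofReal_ne_zero.2 hx.ne'
  have hy' : (y : ℂ) ≠ 0 := Complex.ofReal_ne_zero.2 hy.ne'
  rw [R2, r2, inv_div]
  push_cast
  field_simp

theorem R3_eq_mulConvolution_kernel (α : ℂ) {x y : ℝ} (hx : 0 < x) (hy : 0 < y) :
    R3 α x y =
      (x : ℂ)⁻¹ * (((y / x : ℝ) : ℂ) ^ (-2 : ℂ) • -r1 (-α) (y / x)⁻¹) := by
  have hx' : (x : ℂ) ≠ 0 := Complex.ofReal_ne_zero.2 hx.ne'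
  have hy' : (y : ℂ) ≠ 0 := Complex.ofReal_ne_zero.2 hy.ne'
  rw [R3, r3, r2, inv_div, Complex.cpow_neg, Complex.cpow_ofNat, smul_eq_mul]
  push_cast
  field_simp

/-- Proposition 6: for `0 < Re α ≤ 1/2`, an admissible weight pair
`(φ₁, φ₂)`, `0 < ε < Re α` and `1 - Re α < η < 1`, the space `B_{ε,η}` is
invariant under `R₂₃^α`. -/
theorem stmt18 (α : ℂ) (hα1 : 0 < α.re) (hα2 : α.re ≤ 1/2)
    (φ₁ φ₂ : ℝ → ℝ) (hφ : AdmissiblePair φ₁ φ₂)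
    (ε η : ℝ) (hε1 : 0 < ε) (hε2 : ε < α.re) (hη1 : 1 - α.re < η) (hη2 : η < 1) :
    ∀ f : ℝ → ℂ, MemB ε η f →
      (∀ x : ℝ, 0 < x → IntegrableOn (fun y : ℝ => R23 φ₁ φ₂ α x y * f y) (Ioi 0)) ∧
      MemB ε η (fun x : ℝ => ∫ y in Ioi (0 : ℝ), R23 φ₁ φ₂ α x y * f y) := by
  intro f hf
  obtain ⟨C₁, hC₁⟩ := norm_fst_mul_le hφ hε1 hη2 hf
  obtain ⟨C₂, hC₂⟩ := norm_snd_mul_le hφ hε1 hη2 hf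
  have hk₁ : MellinConvergent (fun t => -r1 (-α) t⁻¹) ((1 - η : ℝ) : ℂ) := by
    have h : MellinConvergent (r1 (-α)) (-((1 - η : ℝ) : ℂ)) :=
      mellinConvergent_r1_neg hα2 (by simp; linarith) (by simp; linarith)
    simpa using (mellinConvergent_comp_inv h).const_smul (-1 : ℂ)
  have hk₂ : MellinConvergent (fun t : ℝ => (t : ℂ) ^ (-2 : ℂ) • -r1 (-α) t⁻¹)
      ((1 - ε : ℝ) : ℂ) := by
    rw [MellinConvergent.cpow_smul]
    have h : MellinConvergent (r1 (-α)) (-(((1 - ε : ℝ) : ℂ) + -2)) :=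
      mellinConvergent_r1_neg hα2 (by simp; linarith) (by simp; linarith)
    simpa using (mellinConvergent_comp_inv h).const_smul (-1 : ℂ)
  obtain ⟨hint₁, hcont₁, D₁, hD₁⟩ := mulConvolution_of_mellinConvergent hk₁
    ((Complex.continuous_ofReal.comp_continuousOn hφ.1).mul hf.1) hC₁
  obtain ⟨hint₂, hcont₂, D₂, hD₂⟩ := mulConvolution_of_mellinConvergent hk₂
    ((Complex.continuous_ofReal.comp_continuousOn hφ.2.1).mul hf.1) hC₂
  have hsplit : ∀ x : ℝ, 0 < x → EqOn
      (fun y : ℝ => (x : ℂ)⁻¹ * -r1 (-α) (y / x)⁻¹ * ((φ₁ y : ℂ) * f y) +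
        (x : ℂ)⁻¹ * (((y / x : ℝ) : ℂ) ^ (-2 : ℂ) • -r1 (-α) (y / x)⁻¹) * ((φ₂ y : ℂ) * f y))
      (fun y => R23 φ₁ φ₂ α x y * f y) (Ioi 0) := by
    intro x hx y hy
    simp only [R23, R2_eq_mulConvolution_kernel α hx hy, R3_eq_mulConvolution_kernel α hx hy]
    ring
  refine ⟨fun x hx =>
    ((hint₁ x hx).add (hint₂ x hx)).congr_fun (hsplit x hx) measurableSet_Ioi, ?_⟩
  have hval : ∀ x : ℝ, 0 < x → _ = ∫ y in Ioi (0 : ℝ), R23 φ₁ φ₂ α x y * f y := fun x hx =>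
    (integral_add (hint₁ x hx) (hint₂ x hx)).symm.trans
      (setIntegral_congr_fun measurableSet_Ioi (hsplit x hx))
  obtain ⟨hc, M, h1, h2⟩ := MemB.of_norm_le (by linarith) hcont₁ hcont₂ hD₁ hD₂
  refine ⟨hc.congr fun x hx => (hval x hx).symm, M, fun x hx => ?_, fun x hx0 hx => ?_⟩
  · beta_reduce
    rw [← hval x (one_pos.trans hx)]
    exact h1 x hx
  · beta_reduce
    rw [← hval x hx0]
    exact h2 x hx0 hx

end
end

section
/- (Corollary 2) Let 0 < ε, η < 1 and let g ∈ B_{ε,η}. Let α ∈ ℂ with 0 < |Re α| ≤ 1/2 and set λ = sin(πα)/π. (a) If Re λ < 0 (i.e., -1/2 ≤ Re α < 0), then there is exactly one f ∈ E satisfying the Stieltjes equation f(x) = g(x) + λ ∫₀^∞ f(y)/(x+y) dy for almost every x > 0, and this f coincides almost everywhere with a function in B_{ε,η}. (b) If Re λ > 0 (i.e., 0 < Re α ≤ 1/2), then for every pair (ε̃, η̃) with [ε̃ = ε if ε < Re α, and ε̃ arbitrary in (0, Re α) otherwise] and [η̃ = η if 1 − Re α < η, and η̃ arbitrary in (1 −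 Re α, 1) otherwise], there exists f ∈ B_{ε̃,η̃} satisfying the Stieltjes equation f(x) = g(x) + λ ∫₀^∞ f(y)/(x+y) dy for all x > 0. -/
open MeasureTheory Set Asymptotics

noncomputable section

/-- Additive convolution of complex functions on the real line. -/
def cv (f g : ℝ → ℂ) (x : ℝ) : ℂ := ∫ t, f t * g (x - t)

/-- Multiplication by the exponential `v ↦ exp (s v)`. -/
def tilt (s : ℂ) (f : ℝ → ℂ) (v : ℝ) : ℂ := Complex.exp (s * v) * f v

/-- Continuous functions that are integrable and bounded after tilting by `exp (c v)`. -/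
structure Nice (c : ℝ) (f : ℝ → ℂ) : Prop where
  cont : Continuous f
  int : Integrable (tilt c f)
  bdd : ∃ M : ℝ, ∀ v, ‖tilt c f v‖ ≤ M

lemma norm_tilt (s : ℂ) (f : ℝ → ℂ) (v : ℝ) :
    ‖tilt s f v‖ = Real.exp (s.re * v) * ‖f v‖ := by
  simp [tilt, Complex.norm_exp]

lemma continuous_tilt {s : ℂ} {f : ℝ → ℂ} : Continuous (tilt s f) ↔ Continuous f := by
  constructor
  · intro h
    have : f = fun v : ℝ => Complex.exp (-(s * v)) * tilt s f v := by
      funext v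
      rw [tilt, ← mul_assoc, ← Complex.exp_add]
      simp
    rw [this]
    fun_prop
  · intro h
    unfold tilt
    fun_prop

lemma tilt_cv (s : ℂ) (f g : ℝ → ℂ) : tilt s (cv f g) = cv (tilt s f) (tilt s g) := by
  funext v
  simp only [tilt, cv]
  rw [← integral_const_mul]
  congr 1
  funext t
  have : Complex.exp (s * v) = Complex.exp (s * t) * Complex.exp (s * ((v - t : ℝ) : ℂ)) := by
    rw [← Complex.exp_add]
    congr 1
    push_cast
    ring
  rw [this]
  ring

lemma cv_eq_convolution (f g : ℝ → ℂ) :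
    cv f g = convolution f g (ContinuousLinearMap.mul ℂ ℂ) volume := rfl

lemma cv_comm (f g : ℝ → ℂ) : cv f g = cv g f := by
  funext x
  unfold cv
  rw [← integral_sub_left_eq_self _ volume x]
  simp [mul_comm]

lemma norm_cv_le {f g : ℝ → ℂ} {M : ℝ} (hf : Integrable f) (hg : ∀ v, ‖g v‖ ≤ M) (x : ℝ) :
    ‖cv f g x‖ ≤ (∫ t, ‖f t‖) * M := by
  unfold cv
  rw [← integral_mul_const]
  refine norm_integral_le_of_norm_le (hf.norm.mul_const M) (.of_forall fun t => ?_)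
  rw [norm_mul]
  gcongr
  exact hg _

lemma continuous_cv {f g : ℝ → ℂ} {M : ℝ} (hf : Integrable f) (hg : Continuous g)
    (hM : ∀ v, ‖g v‖ ≤ M) : Continuous (cv f g) := by
  rw [cv_eq_convolution]
  refine BddAbove.continuous_convolution_right_of_integrable _ ⟨M, ?_⟩ hf hg
  rintro _ ⟨v, rfl⟩
  exact hM v

lemma Nice.conv {c : ℝ} {f g : ℝ → ℂ} (hf : Nice c f) (hg : Nice c g) : Nice c (cv f g) := by
  obtain ⟨M, hM⟩ := hg.bdd
  have hgc := (continuous_tilt (s := c)).2 hg.cont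
  refine ⟨(continuous_tilt (s := c)).1 ?_, ?_, (∫ t, ‖tilt c f t‖) * M, fun v => ?_⟩
  · rw [tilt_cv]
    exact continuous_cv hf.int hgc hM
  · rw [tilt_cv]
    exact hf.int.integrable_convolution (ContinuousLinearMap.mul ℂ ℂ) hg.int
  · rw [tilt_cv]
    exact norm_cv_le hf.int hM v

lemma Nice.const_mul {c : ℝ} {f : ℝ → ℂ} (hf : Nice c f) (a : ℂ) :
    Nice c (fun v => a * f v) := by
  obtain ⟨M, hM⟩ := hf.bdd
  have h : tilt c (fun v => a * f v) = fun v => a * tilt c f v := by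
    funext v
    simp only [tilt]
    ring
  refine ⟨hf.cont.const_mul a, ?_, ‖a‖ * M, fun v => ?_⟩
  · rw [h]
    exact hf.int.const_mul a
  · rw [h, norm_mul]
    gcongr
    exact hM v

lemma Nice.sub {c : ℝ} {f g : ℝ → ℂ} (hf : Nice c f) (hg : Nice c g) :
    Nice c (fun v => f v - g v) := by
  obtain ⟨M, hM⟩ := hf.bdd
  obtain ⟨N, hN⟩ := hg.bdd
  have h : tilt c (fun v => f v - g v) = fun v => tilt c f v - tilt c g v := by
    funext v
    simp only [tilt]
    ring
  refine ⟨hf.cont.sub hg.cont, ?_, M + N, fun v => ?_⟩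
  · rw [h]
    exact hf.int.sub hg.int
  · rw [h]
    exact (norm_sub_le _ _).trans (add_le_add (hM v) (hN v))

lemma Nice.integrable_tilt {c : ℝ} {f : ℝ → ℂ} (hf : Nice c f) {s : ℂ} (hs : s.re = c) :
    Integrable (tilt s f) := by
  refine hf.int.mono (continuous_tilt.2 hf.cont).aestronglyMeasurable (.of_forall fun v => ?_)
  simp [norm_tilt, hs]

lemma laplace_cv {c : ℝ} {f g : ℝ → ℂ} (hf : Nice c f) (hg : Nice c g) {s : ℂ}
    (hs : s.re = c) :
    ∫ v, tilt s (cv f g) v = (∫ v, tilt s f v) * ∫ v, tilt s g v := by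
  rw [tilt_cv, cv_eq_convolution]
  exact integral_convolution (ContinuousLinearMap.mul ℂ ℂ) (hf.integrable_tilt hs)
    (hg.integrable_tilt hs)

open FourierTransform in
lemma Nice.eq_zero {c : ℝ} {f : ℝ → ℂ} (hf : Nice c f)
    (h : ∀ s : ℂ, s.re = c → ∫ v, tilt s f v = 0) (v : ℝ) : f v = 0 := by
  have hF : 𝓕 (tilt c f) = 0 := by
    funext w
    rw [Real.fourier_eq']
    rw [Pi.zero_apply, ← h (c + (-2 * Real.pi * w : ℝ) * Complex.I)
      (by simp)]
    congr 1
    funext v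
    simp only [tilt, smul_eq_mul]
    rw [← mul_assoc, ← Complex.exp_add]
    congr 2
    simp
    ring
  have h0 := hf.int.fourierInv_fourier_eq (by rw [hF]; exact integrable_zero _ _ _)
    (continuous_tilt.2 hf.cont).continuousAt (v := v)
  rw [hF] at h0
  have h1 : tilt c f v = 0 := by
    rw [← h0, Real.fourierInv_eq']
    simp
  simpa [tilt] using h1

/-- The Stieltjes kernel in logarithmic coordinates. -/
def stk (v : ℝ) : ℂ := 1 / (1 + Complex.exp v)

lemma stk_eq_ofReal (v : ℝ) : stk v = ((1 / (1 + Real.exp v) : ℝ) : ℂ) := by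
  simp [stk]

lemma one_add_cexp_ne_zero (v : ℝ) : 1 + Complex.exp v ≠ 0 := by
  have : (1 + Complex.exp v) = ((1 + Real.exp v : ℝ) : ℂ) := by simp
  rw [this, Complex.ofReal_ne_zero]
  positivity

lemma norm_stk (v : ℝ) : ‖stk v‖ = 1 / (1 + Real.exp v) := by
  rw [stk_eq_ofReal, Complex.norm_real, Real.norm_of_nonneg (by positivity)]

lemma continuous_stk : Continuous stk := by
  unfold stk
  exact continuous_const.div (by fun_prop) one_add_cexp_ne_zero

lemma nice_of_exp_bounds {c a b : ℝ} {f : ℝ → ℂ} (hf : Continuous f)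
    (ha : 0 < a + c) (hb : c < b) (h₁ : ∀ v, ‖f v‖ ≤ Real.exp (a * v))
    (h₂ : ∀ v, ‖f v‖ ≤ Real.exp (-b * v)) : Nice c f := by
  have e₁ : ∀ v, ‖tilt c f v‖ ≤ Real.exp ((a + c) * v) := fun v => by
    rw [norm_tilt, add_mul, add_comm, Real.exp_add, Complex.ofReal_re]
    gcongr
    exact h₁ v
  have e₂ : ∀ v, ‖tilt c f v‖ ≤ Real.exp ((c - b) * v) := fun v => by
    rw [norm_tilt, sub_eq_add_neg, add_mul, Real.exp_add, Complex.ofReal_re]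
    gcongr
    exact h₂ v
  have hm := ((continuous_tilt (s := c)).2 hf).aestronglyMeasurable (μ := volume)
  refine ⟨hf, ?_, 1, fun v => ?_⟩
  · rw [← integrableOn_univ, ← Iic_union_Ioi (a := (0 : ℝ))]
    refine IntegrableOn.union ?_ ?_
    · exact (integrableOn_exp_mul_Iic ha 0).mono' hm.restrict (.of_forall e₁)
    · exact (integrableOn_exp_mul_Ioi (sub_neg.2 hb) 0).mono' hm.restrict (.of_forall e₂)
  · rcases le_total v 0 with hv | hv
    · exact (e₁ v).trans (Real.exp_le_one_iff.2 (mul_nonpos_of_nonneg_of_nonpos ha.le hv))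
    · exact (e₂ v).trans (Real.exp_le_one_iff.2
        (mul_nonpos_of_nonpos_of_nonneg (sub_neg.2 hb).le hv))

lemma norm_stk_le_one (v : ℝ) : ‖stk v‖ ≤ 1 := by
  rw [norm_stk, div_le_one (by positivity)]
  linarith [Real.exp_pos v]

lemma norm_stk_le_exp (v : ℝ) : ‖stk v‖ ≤ Real.exp (-v) := by
  rw [norm_stk, Real.exp_neg, ← one_div]
  gcongr
  linarith

lemma nice_stk {c : ℝ} (h₀ : 0 < c) (h₁ : c < 1) : Nice c stk := by
  refine nice_of_exp_bounds (a := 0) (b := 1) continuous_stk (by simpa) h₁ (fun v => ?_)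
    (fun v => ?_)
  · simpa using norm_stk_le_one v
  · simpa using norm_stk_le_exp v

/-- The kernel `t ^ p / (1 + t ^ 2)` in logarithmic coordinates. -/
def powk (p : ℂ) (v : ℝ) : ℂ := Complex.exp (p * v) * stk (2 * v)

lemma nice_powk {c : ℝ} {p : ℂ} (h₀ : 0 < p.re + c) (h₁ : p.re + c < 2) : Nice c (powk p) := by
  have hc : Continuous (powk p) := by
    have := continuous_stk
    unfold powk
    fun_prop
  have hn : ∀ v, ‖powk p v‖ = Real.exp (p.re * v) * ‖stk (2 * v)‖ := fun v => by
    simp [powk, Complex.norm_exp]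
  refine nice_of_exp_bounds (a := p.re) (b := 2 - p.re) hc h₀ (by linarith) (fun v => ?_)
    (fun v => ?_)
  · rw [hn]
    exact mul_le_of_le_one_right (Real.exp_pos _).le (norm_stk_le_one _)
  · rw [hn, show -(2 - p.re) * v = p.re * v + -(2 * v) by ring, Real.exp_add]
    gcongr
    exact norm_stk_le_exp _

lemma laplace_stk {s : ℂ} (h₀ : 0 < s.re) (h₁ : s.re < 1) :
    ∫ v, tilt s stk v = Real.pi / Complex.sin (Real.pi * s) := by
  have hB := Complex.Gamma_mul_Gamma_eq_betaIntegral h₀ (t := 1 - s) (by simpa using h₁)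
  rw [Complex.Gamma_mul_Gamma_one_sub, add_sub_cancel, Complex.Gamma_one, one_mul,
    Complex.betaIntegral, intervalIntegral.integral_of_le zero_le_one,
    integral_Ioc_eq_integral_Ioo, ← Real.range_sigmoid, ← image_univ,
    integral_image_eq_integral_abs_deriv_smul MeasurableSet.univ
      (fun x _ => (Real.hasDerivAt_sigmoid x).hasDerivWithinAt)
      Real.sigmoid_injective.injOn, setIntegral_univ] at hB
  rw [hB]
  congr 1
  funext v
  have e : Real.sigmoid v = Real.exp v * (1 + Real.exp v)⁻¹ := by
    rw [Real.sigmoid_def, Real.exp_neg]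
    have := Real.exp_pos v
    field_simp
    ring
  have e1 : 1 - Real.sigmoid v = (1 + Real.exp v)⁻¹ := by
    rw [e]
    have := Real.exp_pos v
    field_simp
    ring
  set b : ℝ := 1 + Real.exp v with hb
  have hb0 : 0 < b := by positivity
  have hbl : (b : ℂ) = Complex.exp (Real.log b) := by
    rw [← Complex.ofReal_exp, Real.exp_log hb0]
  have e2 : ((1 - Real.sigmoid v : ℝ) : ℂ) = Complex.exp ((-Real.log b : ℝ) : ℂ) := by
    rw [e1, ← Complex.ofReal_exp, Real.exp_neg, Real.exp_log hb0]
  have e3 : ((Real.sigmoid v : ℝ) : ℂ) = Complex.exp ((v - Real.log b : ℝ) : ℂ) := by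
    rw [e, ← Complex.ofReal_exp, Real.exp_sub, Real.exp_log hb0, div_eq_mul_inv]
  have cp : ∀ (x : ℝ) (z : ℂ), Complex.exp x ^ z = Complex.exp (x * z) := fun x z => by
    rw [Complex.cpow_def_of_ne_zero (Complex.exp_ne_zero _), ← Complex.ofReal_exp,
      ← Complex.ofReal_log (Real.exp_pos _).le, Real.log_exp]
  rw [abs_of_nonneg (mul_nonneg (Real.sigmoid_pos v).le (by linarith [Real.sigmoid_lt_one v])),
    Complex.real_smul, Complex.ofReal_mul, ← Complex.ofReal_one, ← Complex.ofReal_sub, e2, e3, cp,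
    cp, tilt, stk_eq_ofReal, ← hb, Complex.ofReal_div, hbl, Complex.ofReal_one, one_div,
    ← Complex.exp_neg]
  simp only [← Complex.exp_add]
  congr 1
  push_cast
  ring

lemma laplace_powk {s p : ℂ} (h₀ : 0 < p.re + s.re) (h₁ : p.re + s.re < 2) :
    ∫ v, tilt s (powk p) v = Real.pi / 2 / Complex.sin (Real.pi * (p + s) / 2) := by
  have h := laplace_stk (s := (p + s) / 2) (by simp; linarith) (by simp; linarith)
  have e : (fun v => tilt s (powk p) v) = fun v => tilt ((p + s) / 2) stk (2 * v) := by
    funext v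
    simp only [tilt, powk]
    rw [← mul_assoc, ← Complex.exp_add]
    congr 2
    push_cast
    ring
  rw [e, Measure.integral_comp_mul_left, h, mul_div_assoc]
  norm_num
  ring

lemma complex_sin_pi_mul_ne_zero {z : ℂ} (h₀ : 0 < z.re) (h₁ : z.re < 1) :
    Complex.sin (Real.pi * z) ≠ 0 := by
  rw [Complex.sin_ne_zero_iff]
  intro k hk
  have hz : z = k := by
    have := Complex.ofReal_ne_zero.2 Real.pi_ne_zero
    rw [mul_comm (k : ℂ)] at hk
    exact mul_left_cancel₀ this hk
  rw [hz, Complex.intCast_re] at h₀ h₁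
  norm_cast at h₀ h₁
  omega

/-- The resolvent kernel with exponents `p`, `q` and strength `a`. -/
def resk (a p q : ℂ) (v : ℝ) : ℂ := a * cv (powk p) (powk q) v

lemma nice_resk {c : ℝ} (a : ℂ) {p q : ℂ} (hp₀ : 0 < p.re + c) (hp₁ : p.re + c < 2)
    (hq₀ : 0 < q.re + c) (hq₁ : q.re + c < 2) : Nice c (resk a p q) :=
  ((nice_powk hp₀ hp₁).conv (nice_powk hq₀ hq₁)).const_mul a

lemma resk_eq {σ p q α lam : ℂ} {c : ℝ} (hc₀ : 0 < c) (hc₁ : c < 1)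
    (hp₀ : 0 < p.re + c) (hp₁ : p.re + c < 2) (hq₀ : 0 < q.re + c) (hq₁ : q.re + c < 2)
    (hlam : lam = Complex.sin (Real.pi * α) / Real.pi)
    (h : ∀ s : ℂ, 2 * Complex.sin (Real.pi * (p + s) / 2) * Complex.sin (Real.pi * (q + s) / 2) =
      σ * (Complex.sin (Real.pi * s) - Complex.sin (Real.pi * α))) (v : ℝ) :
    resk (2 * lam * σ / Real.pi) p q v =
      lam * stk v + lam * cv stk (resk (2 * lam * σ / Real.pi) p q) v := by
  set r := resk (2 * lam * σ / Real.pi) p q with hr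
  have hrn : Nice c r := nice_resk _ hp₀ hp₁ hq₀ hq₁
  have hk := nice_stk hc₀ hc₁
  have hD := ((hrn.sub (hk.const_mul lam)).sub ((hk.conv hrn).const_mul lam)).eq_zero ?_ v
  · linear_combination hD
  intro s hs
  have e : (fun v => tilt s (fun v => r v - lam * stk v - lam * cv stk r v) v) =
      fun v => tilt s r v - lam * tilt s stk v - lam * tilt s (cv stk r) v := by
    funext v
    simp only [tilt]
    ring
  have er : (fun v => tilt s r v) =
      fun v => (2 * lam * σ / Real.pi) * tilt s (cv (powk p) (powk q)) v := by
    funext v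
    simp only [tilt, hr, resk]
    ring
  have hpi : (Real.pi : ℂ) ≠ 0 := Complex.ofReal_ne_zero.2 Real.pi_ne_zero
  have hrs : ∫ v, tilt s r v = (2 * lam * σ / Real.pi) *
      ((Real.pi / 2 / Complex.sin (Real.pi * (p + s) / 2)) *
        (Real.pi / 2 / Complex.sin (Real.pi * (q + s) / 2))) := by
    rw [er, integral_const_mul, laplace_cv (nice_powk hp₀ hp₁) (nice_powk hq₀ hq₁) hs,
      laplace_powk (by rwa [hs]) (by rwa [hs]), laplace_powk (by rwa [hs]) (by rwa [hs])]
  have i1 := hrn.integrable_tilt hs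
  have i2 := (hk.integrable_tilt hs).const_mul lam
  have i3 := ((hk.conv hrn).integrable_tilt hs).const_mul lam
  have i12 : Integrable fun v => tilt s r v - lam * tilt s stk v := i1.sub i2
  rw [e, integral_sub i12 i3, integral_sub i1 i2, integral_const_mul, integral_const_mul,
    laplace_cv hk hrn hs, hrs, laplace_stk (by rwa [hs]) (by rwa [hs])]
  have s0 : Complex.sin (Real.pi * s) ≠ 0 := complex_sin_pi_mul_ne_zero (by rwa [hs]) (by rwa [hs])
  have sp : Complex.sin (Real.pi * (p + s) / 2) ≠ 0 := by
    rw [mul_div_assoc]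
    exact complex_sin_pi_mul_ne_zero (by simp; linarith) (by simp; linarith)
  have sq : Complex.sin (Real.pi * (q + s) / 2) ≠ 0 := by
    rw [mul_div_assoc]
    exact complex_sin_pi_mul_ne_zero (by simp; linarith) (by simp; linarith)
  have hs' := h s
  have hA : Complex.sin (Real.pi * α) = Real.pi * lam := by
    rw [hlam]
    field_simp
  rw [hA] at hs'
  generalize Complex.sin (Real.pi * s) = S at *
  generalize Complex.sin (Real.pi * (p + s) / 2) = P at *
  generalize Complex.sin (Real.pi * (q + s) / 2) = Q at *
  field_simp
  linear_combination (-lam * Real.pi) * hs'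

lemma integrable_mul_of_exp_bound {f g : ℝ → ℂ} {c₁ c₂ M : ℝ}
    (hf : AEStronglyMeasurable f) (h₁ : Integrable (tilt c₁ f)) (h₂ : Integrable (tilt c₂ f))
    (hg : AEStronglyMeasurable g)
    (hM : ∀ v, ‖g v‖ ≤ M * (Real.exp (-c₁ * v) + Real.exp (-c₂ * v))) (x : ℝ) :
    Integrable fun t => f t * g (x - t) := by
  have hgm : AEStronglyMeasurable fun t => g (x - t) :=
    hg.comp_quasiMeasurePreserving (quasiMeasurePreserving_sub_left volume x)
  refine ((h₁.norm.const_mul (M * Real.exp (-c₁ * x))).add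
    (h₂.norm.const_mul (M * Real.exp (-c₂ * x)))).mono' (hf.mul hgm) (.of_forall fun t => ?_)
  have e : ∀ c : ℝ, Real.exp (-c * (x - t)) = Real.exp (-c * x) * Real.exp (c * t) := fun c => by
    rw [← Real.exp_add]
    ring_nf
  have h := mul_le_mul_of_nonneg_left (hM (x - t)) (norm_nonneg (f t))
  rw [e, e] at h
  simp only [norm_mul, Pi.add_apply, norm_tilt, Complex.ofReal_re]
  refine h.trans (le_of_eq ?_)
  ring

lemma integral_norm_mul_le {f g : ℝ → ℂ} {c M : ℝ} (hf : Integrable (tilt c f))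
    (hM : ∀ v, ‖g v‖ ≤ M * Real.exp (-c * v)) (x : ℝ) :
    ∫ t, ‖f t‖ * ‖g (x - t)‖ ≤ (∫ t, ‖tilt c f t‖) * M * Real.exp (-c * x) := by
  rw [mul_assoc, ← integral_mul_const]
  refine integral_mono_of_nonneg (.of_forall fun t => by positivity) (hf.norm.mul_const _)
    (.of_forall fun t => ?_)
  have e : Real.exp (-c * (x - t)) = Real.exp (-c * x) * Real.exp (c * t) := by
    rw [← Real.exp_add]
    ring_nf
  have h := mul_le_mul_of_nonneg_left (hM (x - t)) (norm_nonneg (f t))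
  rw [e] at h
  simp only [norm_tilt, Complex.ofReal_re]
  refine h.trans (le_of_eq ?_)
  ring

lemma norm_cv_le_exp {f g : ℝ → ℂ} {c M : ℝ} (hf : Integrable (tilt c f))
    (hM : ∀ v, ‖g v‖ ≤ M * Real.exp (-c * v)) (x : ℝ) :
    ‖cv f g x‖ ≤ (∫ t, ‖tilt c f t‖) * M * Real.exp (-c * x) := by
  refine (norm_integral_le_integral_norm _).trans ?_
  simp only [norm_mul]
  exact integral_norm_mul_le hf hM x

lemma cv_assoc {f g k : ℝ → ℂ} {c₁ c₂ M : ℝ} (hf : AEStronglyMeasurable f)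
    (hg : AEStronglyMeasurable g) (hk : AEStronglyMeasurable k)
    (h₁ : Integrable (tilt c₁ f)) (h₂ : Integrable (tilt c₂ f))
    (hfg : ∀ y, Integrable fun t => f t * g (y - t))
    (hgk : ∀ y, Integrable fun t => g t * k (y - t))
    (hM : ∀ y, ∫ t, ‖g t‖ * ‖k (y - t)‖ ≤ M * (Real.exp (-c₁ * y) + Real.exp (-c₂ * y)))
    (x : ℝ) : cv (cv f g) k x = cv f (cv g k) x := by
  have hm : AEStronglyMeasurable (fun y => ∫ t, ‖g t‖ * ‖k (y - t)‖) :=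
    (AEStronglyMeasurable.convolution_integrand (μ := volume) (ν := volume)
      (ContinuousLinearMap.mul ℝ ℝ) hg.norm hk.norm).integral_prod_right'
  have hm' : AEStronglyMeasurable (fun y => ((∫ t, ‖g t‖ * ‖k (y - t)‖ : ℝ) : ℂ)) :=
    Complex.continuous_ofReal.comp_aestronglyMeasurable hm
  refine convolution_assoc (ContinuousLinearMap.mul ℂ ℂ) (ContinuousLinearMap.mul ℂ ℂ)
    (ContinuousLinearMap.mul ℂ ℂ) (ContinuousLinearMap.mul ℂ ℂ) (fun a b d => mul_assoc a b d)
    hf hg hk (.of_forall hfg) (.of_forall fun y => ?_) ?_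
  · have := (hgk y).norm
    simp only [norm_mul] at this
    exact this
  · have := (integrable_mul_of_exp_bound hf h₁ h₂ hm' (M := M) (fun v => ?_) x).norm
    · refine this.congr (.of_forall fun t => ?_)
      have h0 : 0 ≤ ∫ u, ‖g u‖ * ‖k (x - t - u)‖ := integral_nonneg fun u => by positivity
      simp only [norm_mul, Complex.norm_real, Real.norm_of_nonneg h0]
      rfl
    · rw [Complex.norm_real, Real.norm_of_nonneg (integral_nonneg fun u => by positivity)]
      exact hM v

lemma cv_resolvent {r G : ℝ → ℂ} {c M : ℝ} {lam : ℂ} (hc₀ : 0 < c) (hc₁ : c < 1)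
    (hr : Nice c r) (hres : ∀ v, r v = lam * stk v + lam * cv stk r v) (hG : Continuous G)
    (hM : ∀ v, ‖G v‖ ≤ M * Real.exp (-c * v)) :
    Continuous (cv r G) ∧ ∀ x, Integrable (fun t => stk t * G (x - t)) ∧
      Integrable (fun t => stk t * cv r G (x - t)) ∧
      cv r G x = lam * cv stk G x + lam * cv stk (cv r G) x := by
  have hk := nice_stk hc₀ hc₁
  have hM' : ∀ v, ‖G v‖ ≤ M / 2 * (Real.exp (-c * v) + Real.exp (-c * v)) := fun v => by
    linarith [hM v]
  have hcont : Continuous (cv r G) := by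
    rw [← continuous_tilt (s := c), tilt_cv]
    refine continuous_cv hr.int (continuous_tilt.2 hG) (M := M) fun v => ?_
    rw [norm_tilt, Complex.ofReal_re]
    calc Real.exp (c * v) * ‖G v‖ ≤ Real.exp (c * v) * (M * Real.exp (-c * v)) := by
          gcongr
          exact hM v
      _ = M * (Real.exp (c * v) * Real.exp (-c * v)) := by ring
      _ = M := by simp [← Real.exp_add]
  have i₁ := integrable_mul_of_exp_bound hk.cont.aestronglyMeasurable hk.int hk.int
    hG.aestronglyMeasurable hM'
  have hrG := integrable_mul_of_exp_bound hr.cont.aestronglyMeasurable hr.int hr.int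
    hG.aestronglyMeasurable hM'
  set A := (∫ t, ‖tilt c r t‖) * M with hA
  have hb : ∀ v, ‖cv r G v‖ ≤ A / 2 * (Real.exp (-c * v) + Real.exp (-c * v)) := fun v => by
    linarith [norm_cv_le_exp hr.int hM v]
  have i₂ := integrable_mul_of_exp_bound hk.cont.aestronglyMeasurable hk.int hk.int
    hcont.aestronglyMeasurable hb
  obtain ⟨N, hN⟩ := hr.bdd
  have hkr : ∀ x, Integrable fun t => stk t * r (x - t) :=
    integrable_mul_of_exp_bound (M := N / 2) hk.cont.aestronglyMeasurable hk.int hk.int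
      hr.cont.aestronglyMeasurable fun v => by
        have h := hN v
        rw [norm_tilt, Complex.ofReal_re] at h
        rw [← add_halves ‖r v‖]
        have : ‖r v‖ ≤ N * Real.exp (-c * v) := by
          rw [neg_mul, Real.exp_neg, ← div_eq_mul_inv, le_div_iff₀ (Real.exp_pos _), mul_comm]
          exact h
        linarith
  refine ⟨hcont, fun x => ⟨i₁ x, i₂ x, ?_⟩⟩
  rw [← cv_assoc (M := A / 2) hk.cont.aestronglyMeasurable hr.cont.aestronglyMeasurable
    hG.aestronglyMeasurable hk.int hk.int hkr hrG
    (fun y => by linarith [integral_norm_mul_le hr.int hM y])]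
  have j₂ : Integrable fun t => lam * (cv stk r t * G (x - t)) := by
    have : (fun t => lam * (cv stk r t * G (x - t))) =
        fun t => r t * G (x - t) - lam * (stk t * G (x - t)) := by
      funext t
      rw [hres t]
      ring
    rw [this]
    exact (hrG x).sub ((i₁ x).const_mul lam)
  have e : cv r G x = ∫ t, (lam * (stk t * G (x - t)) + lam * (cv stk r t * G (x - t))) := by
    unfold cv
    congr 1
    funext t
    rw [hres t, cv]
    ring
  rw [e, integral_add ((i₁ x).const_mul lam) j₂, integral_const_mul, integral_const_mul]
  rfl

lemma exp_mul_norm_le {x : ℂ} {c v A : ℝ} (h : ‖x‖ ≤ A * Real.exp (-c * v)) :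
    Real.exp (c * v) * ‖x‖ ≤ A := by
  rw [neg_mul, Real.exp_neg, ← div_eq_mul_inv, le_div_iff₀ (Real.exp_pos _)] at h
  rwa [mul_comm]

lemma exp_neg_mul_le {c d v : ℝ} (h : 0 ≤ (c - d) * v) :
    Real.exp (-c * v) ≤ Real.exp (-d * v) := by
  rw [Real.exp_le_exp]
  linarith

lemma exists_log_solution {ε η ε' η' M : ℝ} {lam : ℂ} {r₁ r₂ G : ℝ → ℂ}
    (hε₀ : 0 < ε') (hε₁ : ε' < 1) (hε : ε' ≤ ε) (hη₀ : 0 < η') (hη₁ : η' < 1) (hη : η ≤ η')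
    (h₁ : Nice ε' r₁) (h₁' : Nice (min ε' η') r₁) (h₂ : Nice η' r₂) (h₂' : Nice (max ε' η') r₂)
    (hr₁ : ∀ v, r₁ v = lam * stk v + lam * cv stk r₁ v)
    (hr₂ : ∀ v, r₂ v = lam * stk v + lam * cv stk r₂ v)
    (hG : Continuous G) (hGp : ∀ v, 0 ≤ v → ‖G v‖ ≤ M * Real.exp (-ε * v))
    (hGn : ∀ v, v ≤ 0 → ‖G v‖ ≤ M * Real.exp (-η * v)) :
    ∃ F : ℝ → ℂ, Continuous F ∧
      (∃ N : ℝ, (∀ v, 0 < v → Real.exp (ε' * v) * ‖F v‖ ≤ N) ∧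
        ∀ v, v < 0 → Real.exp (η' * v) * ‖F v‖ ≤ N) ∧
      ∀ x, Integrable (fun t => stk t * F (x - t)) ∧ F x = G x + lam * cv stk F x := by
  have hM0 : 0 ≤ M := by
    have := (norm_nonneg _).trans (hGp 0 le_rfl)
    simpa using this
  set G₁ : ℝ → ℂ := fun v => G (max v 0) with hG₁
  set G₂ : ℝ → ℂ := fun v => G v - G₁ v with hG₂
  have c₁ : Continuous G₁ := by fun_prop
  have c₂ : Continuous G₂ := hG.sub c₁
  have b₁ : ∀ c, 0 ≤ c → c ≤ ε → ∀ v, ‖G₁ v‖ ≤ M * Real.exp (-c * v) := by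
    intro c hc hcε v
    refine (hGp _ (le_max_right v 0)).trans (mul_le_mul_of_nonneg_left ?_ hM0)
    rw [Real.exp_le_exp]
    nlinarith [le_max_left v 0, le_max_right v 0]
  have b₂ : ∀ c, 0 ≤ c → η ≤ c → ∀ v, ‖G₂ v‖ ≤ (2 * M) * Real.exp (-c * v) := by
    intro c hc hcη v
    rcases le_total 0 v with hv | hv
    · have : G₂ v = 0 := by simp [hG₂, hG₁, max_eq_left hv]
      rw [this, norm_zero]
      positivity
    · have h0 := b₁ 0 le_rfl (hε₀.le.trans hε) v
      have e1 : Real.exp (-0 * v) ≤ Real.exp (-c * v) := exp_neg_mul_le (by nlinarith)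
      have e2 : Real.exp (-η * v) ≤ Real.exp (-c * v) := exp_neg_mul_le (by nlinarith)
      have := norm_sub_le (G v) (G₁ v)
      have h3 := mul_le_mul_of_nonneg_left e1 hM0
      have h4 := mul_le_mul_of_nonneg_left e2 hM0
      have h5 := hGn v hv
      change ‖G v - G₁ v‖ ≤ _
      linarith
  have hmin₀ : 0 < min ε' η' := lt_min hε₀ hη₀
  have hmax₀ : 0 < max ε' η' := lt_max_of_lt_left hε₀
  obtain ⟨d₁, p₁⟩ := cv_resolvent hε₀ hε₁ h₁ hr₁ c₁ (b₁ ε' hε₀.le hε)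
  obtain ⟨d₂, p₂⟩ := cv_resolvent hη₀ hη₁ h₂ hr₂ c₂ (b₂ η' hη₀.le hη)
  have u₁ := norm_cv_le_exp h₁.int (b₁ ε' hε₀.le hε)
  have u₁' := norm_cv_le_exp h₁'.int (b₁ _ hmin₀.le ((min_le_left _ _).trans hε))
  have u₂ := norm_cv_le_exp h₂.int (b₂ η' hη₀.le hη)
  have u₂' := norm_cv_le_exp h₂'.int (b₂ _ hmax₀.le (hη.trans (le_max_right _ _)))
  set A₁ := (∫ t, ‖tilt (ε' : ℝ) r₁ t‖) * M
  set A₁' := (∫ t, ‖tilt (min ε' η' : ℝ) r₁ t‖) * M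
  set A₂ := (∫ t, ‖tilt (η' : ℝ) r₂ t‖) * (2 * M)
  set A₂' := (∫ t, ‖tilt (max ε' η' : ℝ) r₂ t‖) * (2 * M)
  have A₁0 : 0 ≤ A₁ := mul_nonneg (integral_nonneg fun t => norm_nonneg _) hM0
  have A₁0' : 0 ≤ A₁' := mul_nonneg (integral_nonneg fun t => norm_nonneg _) hM0
  have A₂0 : 0 ≤ A₂ := mul_nonneg (integral_nonneg fun t => norm_nonneg _) (by positivity)
  have A₂0' : 0 ≤ A₂' := mul_nonneg (integral_nonneg fun t => norm_nonneg _) (by positivity)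
  refine ⟨fun v => G v + cv r₁ G₁ v + cv r₂ G₂ v, (hG.add d₁).add d₂,
    ⟨M + (A₁ + A₁') + (A₂ + A₂'), fun v hv => ?_, fun v hv => ?_⟩, fun x => ?_⟩
  · refine exp_mul_norm_le (norm_add₃_le.trans ?_)
    have e1 : Real.exp (-ε * v) ≤ Real.exp (-ε' * v) := exp_neg_mul_le (by nlinarith)
    have e2 : Real.exp (-max ε' η' * v) ≤ Real.exp (-ε' * v) :=
      exp_neg_mul_le (by nlinarith [le_max_left ε' η'])
    have h1 := (hGp v hv.le).trans (mul_le_mul_of_nonneg_left e1 hM0)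
    have h2 := (u₂' v).trans (mul_le_mul_of_nonneg_left e2 A₂0')
    have h3 := u₁ v
    have := mul_nonneg (add_nonneg A₁0' A₂0) (Real.exp_pos (-ε' * v)).le
    linarith
  · refine exp_mul_norm_le (norm_add₃_le.trans ?_)
    have e1 : Real.exp (-η * v) ≤ Real.exp (-η' * v) := exp_neg_mul_le (by nlinarith)
    have e2 : Real.exp (-min ε' η' * v) ≤ Real.exp (-η' * v) :=
      exp_neg_mul_le (by nlinarith [min_le_right ε' η'])
    have h1 := (hGn v hv.le).trans (mul_le_mul_of_nonneg_left e1 hM0)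
    have h2 := (u₁' v).trans (mul_le_mul_of_nonneg_left e2 A₁0')
    have h3 := u₂ v
    have := mul_nonneg (add_nonneg A₁0 A₂0') (Real.exp_pos (-η' * v)).le
    linarith
  · obtain ⟨i₁, j₁, q₁⟩ := p₁ x
    obtain ⟨i₂, j₂, q₂⟩ := p₂ x
    have e : (fun t => stk t * (G (x - t) + cv r₁ G₁ (x - t) + cv r₂ G₂ (x - t))) =
        fun t => ((stk t * G₁ (x - t) + stk t * cv r₁ G₁ (x - t)) +
          (stk t * G₂ (x - t) + stk t * cv r₂ G₂ (x - t))) := by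
      funext t
      simp only [hG₂]
      ring
    have a₁ : Integrable fun t => stk t * G₁ (x - t) + stk t * cv r₁ G₁ (x - t) := i₁.add j₁
    have a₂ : Integrable fun t => stk t * G₂ (x - t) + stk t * cv r₂ G₂ (x - t) := i₂.add j₂
    have key : cv stk (fun v => G v + cv r₁ G₁ v + cv r₂ G₂ v) x =
        cv stk G₁ x + cv stk (cv r₁ G₁) x + (cv stk G₂ x + cv stk (cv r₂ G₂) x) := by
      change (∫ t, stk t * (G (x - t) + cv r₁ G₁ (x - t) + cv r₂ G₂ (x - t))) = _
      rw [e, integral_add a₁ a₂, integral_add i₁ j₁, integral_add i₂ j₂]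
      rfl
    refine ⟨?_, ?_⟩
    · rw [e]
      exact a₁.add a₂
    · rw [key]
      linear_combination q₁ + q₂

lemma stk_ne_zero (v : ℝ) : stk v ≠ 0 :=
  one_div_ne_zero (one_add_cexp_ne_zero v)

lemma norm_stk_sub_le (v w : ℝ) : ‖stk (v - w)‖ ≤ (1 + Real.exp (-v)) * ‖stk (-w)‖ := by
  rw [norm_stk, norm_stk, mul_one_div, div_le_div_iff₀ (by positivity) (by positivity)]
  have e : Real.exp (-v) * Real.exp (v - w) = Real.exp (-w) := by
    rw [← Real.exp_add]
    ring_nf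
  nlinarith [Real.exp_pos (-v), Real.exp_pos (v - w)]

lemma eq_zero_of_homogeneous {r F : ℝ → ℂ} {lam : ℂ} (h₀ : Nice 0 r) (h₁ : Nice 1 r)
    (hres : ∀ v, r v = lam * stk v + lam * cv stk r v)
    (hi : ∀ x, Integrable fun t => stk t * F (x - t))
    (hF : ∀ x, F x = lam * cv stk F x) (x : ℝ) : F x = 0 := by
  have hFm : AEStronglyMeasurable F := by
    have hm : AEStronglyMeasurable fun t => F (0 - t) := by
      have e : (fun t => F (0 - t)) = fun t => (stk t)⁻¹ * (stk t * F (0 - t)) := by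
        funext t
        rw [inv_mul_cancel_left₀ (stk_ne_zero t)]
      rw [e]
      exact (continuous_stk.inv₀ stk_ne_zero).aestronglyMeasurable.mul (hi 0).aestronglyMeasurable
    simpa [Function.comp_def] using hm.comp_quasiMeasurePreserving (quasiMeasurePreserving_sub_left volume (0 : ℝ))
  set B := ∫ t, ‖stk t * F (0 - t)‖ with hB
  have hb : ∀ y, ∫ t, ‖stk t‖ * ‖F (y - t)‖ ≤
      B * (Real.exp (-(0 : ℝ) * y) + Real.exp (-(1 : ℝ) * y)) := by
    intro y
    rw [← integral_sub_left_eq_self _ volume y, hB,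
      ← integral_sub_left_eq_self (fun t => ‖stk t * F (0 - t)‖) volume (0 : ℝ),
      ← integral_mul_const]
    have hi0 := ((hi 0).comp_sub_left (0 : ℝ)).norm
    refine integral_mono_of_nonneg (.of_forall fun t => by positivity) (hi0.mul_const _)
      (.of_forall fun t => ?_)
    have := mul_le_mul_of_nonneg_right (norm_stk_sub_le y t) (norm_nonneg (F t))
    simp only [sub_sub_cancel, norm_mul, neg_zero, zero_mul, Real.exp_zero, neg_mul, one_mul,
      zero_sub, neg_neg]
    linarith
  have hFb : ∀ v, ‖F v‖ ≤ ‖lam‖ * B *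
      (Real.exp (-(0 : ℝ) * v) + Real.exp (-(1 : ℝ) * v)) := fun v => by
    rw [hF v, norm_mul, mul_assoc]
    gcongr
    refine (norm_integral_le_integral_norm _).trans ?_
    simp only [norm_mul]
    exact hb v
  have hrF := integrable_mul_of_exp_bound h₀.cont.aestronglyMeasurable h₀.int h₁.int hFm hFb
  have hrk : ∀ y, Integrable fun t => r t * stk (y - t) :=
    integrable_mul_of_exp_bound (M := 1) h₀.cont.aestronglyMeasurable h₀.int h₁.int
      continuous_stk.aestronglyMeasurable fun v => by
        have := norm_stk_le_one v
        have := Real.exp_pos (-(1 : ℝ) * v)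
        simp only [neg_zero, zero_mul, Real.exp_zero]
        linarith
  have hassoc := cv_assoc h₀.cont.aestronglyMeasurable continuous_stk.aestronglyMeasurable hFm
    h₀.int h₁.int hrk hi hb x
  rw [cv_comm r stk] at hassoc
  have e₁ : cv r F x = lam * cv r (cv stk F) x := by
    unfold cv
    rw [← integral_const_mul]
    congr 1
    funext t
    rw [hF (x - t)]
    unfold cv
    ring
  have e₂ : lam * cv (cv stk r) F x = cv r F x - lam * cv stk F x := by
    unfold cv
    rw [← integral_const_mul, ← integral_const_mul, ← integral_sub (hrF x) ((hi x).const_mul lam)]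
    congr 1
    funext t
    rw [hres t]
    unfold cv
    ring
  rw [hF x]
  linear_combination e₂ - lam * hassoc + e₁

lemma stieltjes_comp_exp (f : ℝ → ℂ) (x w : ℝ) :
    |Real.exp w| • (f (Real.exp w) / ((Real.exp x : ℂ) + (Real.exp w : ℂ))) =
      stk (x - w) * f (Real.exp w) := by
  have h : (Real.exp x : ℂ) + (Real.exp w : ℂ) ≠ 0 := by
    rw [← Complex.ofReal_add, Complex.ofReal_ne_zero]
    positivity
  have h' : stk (x - w) = Real.exp w / ((Real.exp x : ℂ) + (Real.exp w : ℂ)) := by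
    rw [stk_eq_ofReal, Real.exp_sub, ← Complex.ofReal_add, ← Complex.ofReal_div]
    congr 1
    field_simp
    ring
  rw [h', abs_of_pos (Real.exp_pos w), Complex.real_smul]
  ring

lemma integrableOn_stieltjes_iff (f : ℝ → ℂ) (x : ℝ) :
    IntegrableOn (fun y : ℝ => f y / ((Real.exp x : ℂ) + (y : ℂ))) (Ioi 0) ↔
      Integrable fun t => stk t * f (Real.exp (x - t)) := by
  rw [← Real.range_exp, ← image_univ,
    integrableOn_image_iff_integrableOn_abs_deriv_smul MeasurableSet.univ
      (fun x _ => (Real.hasDerivAt_exp x).hasDerivWithinAt) Real.exp_injective.injOn,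
    integrableOn_univ]
  simp only [stieltjes_comp_exp]
  rw [← integrable_comp_sub_left _ x]
  simp

lemma integral_stieltjes (f : ℝ → ℂ) (x : ℝ) :
    ∫ y in Ioi (0 : ℝ), f y / ((Real.exp x : ℂ) + (y : ℂ)) =
      cv stk (fun v => f (Real.exp v)) x := by
  rw [← Real.range_exp, ← image_univ,
    integral_image_eq_integral_abs_deriv_smul MeasurableSet.univ
      (fun x _ => (Real.hasDerivAt_exp x).hasDerivWithinAt) Real.exp_injective.injOn,
    setIntegral_univ]
  simp only [stieltjes_comp_exp]
  rw [← integral_sub_left_eq_self _ volume x]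
  simp [cv]

lemma MemB.log_bounds {ε η : ℝ} {g : ℝ → ℂ} (hg : MemB ε η g) :
    Continuous (fun v => g (Real.exp v)) ∧ ∃ M : ℝ,
      (∀ v, 0 ≤ v → ‖g (Real.exp v)‖ ≤ M * Real.exp (-ε * v)) ∧
      ∀ v, v ≤ 0 → ‖g (Real.exp v)‖ ≤ M * Real.exp (-η * v) := by
  obtain ⟨hc, M, h₁, h₂⟩ := hg
  have key : ∀ (a v K : ℝ), Real.exp v ^ a * ‖g (Real.exp v)‖ ≤ K →
      ‖g (Real.exp v)‖ ≤ K * Real.exp (-a * v) := by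
    intro a v K h
    rw [← Real.exp_mul, mul_comm, mul_comm v] at h
    rwa [neg_mul, Real.exp_neg, ← div_eq_mul_inv, le_div_iff₀ (Real.exp_pos _)]
  refine ⟨hc.comp_continuous Real.continuous_exp Real.exp_pos, max M ‖g 1‖,
    fun v hv => ?_, fun v hv => ?_⟩
  · rcases hv.eq_or_lt with rfl | hv
    · simp
    · exact key _ _ _ ((h₁ _ (Real.one_lt_exp_iff.2 hv)).trans (le_max_left _ _))
  · rcases hv.eq_or_lt with rfl | hv
    · simp
    · exact key _ _ _ ((h₂ _ (Real.exp_pos v) (by rw [← Real.exp_zero]; exact Real.exp_lt_exp.2 hv)).trans (le_max_left _ _))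

lemma MemB.exists_solution {ε η ε' η' : ℝ} {lam : ℂ} {r₁ r₂ g : ℝ → ℂ} (hg : MemB ε η g)
    (hε₀ : 0 < ε') (hε₁ : ε' < 1) (hε : ε' ≤ ε) (hη₀ : 0 < η') (hη₁ : η' < 1) (hη : η ≤ η')
    (h₁ : Nice ε' r₁) (h₁' : Nice (min ε' η') r₁) (h₂ : Nice η' r₂) (h₂' : Nice (max ε' η') r₂)
    (hr₁ : ∀ v, r₁ v = lam * stk v + lam * cv stk r₁ v)
    (hr₂ : ∀ v, r₂ v = lam * stk v + lam * cv stk r₂ v) :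
    ∃ f : ℝ → ℂ, MemB ε' η' f ∧ ∀ x : ℝ, 0 < x →
      IntegrableOn (fun y : ℝ => f y / ((x : ℂ) + (y : ℂ))) (Ioi 0) ∧
      f x = g x + lam * ∫ y in Ioi (0 : ℝ), f y / ((x : ℂ) + (y : ℂ)) := by
  obtain ⟨hc, M, hp, hn⟩ := hg.log_bounds
  obtain ⟨F, hF, ⟨N, hNp, hNn⟩, hsol⟩ :=
    exists_log_solution hε₀ hε₁ hε hη₀ hη₁ hη h₁ h₁' h₂ h₂' hr₁ hr₂ hc hp hn
  have pw : ∀ x a : ℝ, 0 < x → x ^ a = Real.exp (a * Real.log x) := fun x a hx => by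
    rw [Real.rpow_def_of_pos hx, mul_comm]
  refine ⟨fun x => F (Real.log x), ⟨?_, N, fun x hx => ?_, fun x hx₀ hx₁ => ?_⟩, fun x hx => ?_⟩
  · exact hF.comp_continuousOn (Real.continuousOn_log.mono fun x hx => (mem_Ioi.1 hx).ne')
  · rw [pw x _ (by linarith)]
    exact hNp _ (Real.log_pos hx)
  · rw [pw x _ hx₀]
    exact hNn _ (Real.log_neg hx₀ hx₁)
  · obtain ⟨v, rfl⟩ : ∃ v, Real.exp v = x := ⟨_, Real.exp_log hx⟩
    rw [integrableOn_stieltjes_iff, integral_stieltjes]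
    simp only [Real.log_exp]
    exact hsol v

lemma stieltjes_congr {f h : ℝ → ℂ} (hfh : f =ᵐ[volume.restrict (Ioi (0 : ℝ))] h) (x : ℝ) :
    (fun y : ℝ => f y / ((x : ℂ) + (y : ℂ))) =ᵐ[volume.restrict (Ioi (0 : ℝ))]
      fun y : ℝ => h y / ((x : ℂ) + (y : ℂ)) :=
  hfh.mono fun y hy => by simp only [hy]

lemma ae_eq_of_stieltjes {g r f₁ f₂ : ℝ → ℂ} {lam : ℂ} (h₀ : Nice 0 r) (h₁ : Nice 1 r)
    (hres : ∀ v, r v = lam * stk v + lam * cv stk r v)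
    (hi₁ : ∀ x : ℝ, 0 < x → IntegrableOn (fun y : ℝ => f₁ y / ((x : ℂ) + (y : ℂ))) (Ioi 0))
    (hf₁ : ∀ᵐ x ∂(volume.restrict (Ioi (0 : ℝ))),
      f₁ x = g x + lam * ∫ y in Ioi (0 : ℝ), f₁ y / ((x : ℂ) + (y : ℂ)))
    (hi₂ : ∀ x : ℝ, 0 < x → IntegrableOn (fun y : ℝ => f₂ y / ((x : ℂ) + (y : ℂ))) (Ioi 0))
    (hf₂ : ∀ᵐ x ∂(volume.restrict (Ioi (0 : ℝ))),
      f₂ x = g x + lam * ∫ y in Ioi (0 : ℝ), f₂ y / ((x : ℂ) + (y : ℂ))) :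
    f₁ =ᵐ[volume.restrict (Ioi (0 : ℝ))] f₂ := by
  set f : ℝ → ℂ := fun x => f₁ x - f₂ x with hf
  set h : ℝ → ℂ := fun x => lam * ∫ y in Ioi (0 : ℝ), f y / ((x : ℂ) + (y : ℂ)) with hh
  have hi : ∀ x : ℝ, 0 < x → IntegrableOn (fun y : ℝ => f y / ((x : ℂ) + (y : ℂ))) (Ioi 0) := by
    intro x hx
    refine ((hi₁ x hx).sub (hi₂ x hx)).congr (.of_forall fun y => ?_)
    simp only [hf, Pi.sub_apply]
    ring
  have hfh : f =ᵐ[volume.restrict (Ioi (0 : ℝ))] h := by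
    filter_upwards [hf₁, hf₂, ae_restrict_mem measurableSet_Ioi] with x e₁ e₂ hx
    have e : ∫ y in Ioi (0 : ℝ), f y / ((x : ℂ) + (y : ℂ)) =
        (∫ y in Ioi (0 : ℝ), f₁ y / ((x : ℂ) + (y : ℂ))) -
          ∫ y in Ioi (0 : ℝ), f₂ y / ((x : ℂ) + (y : ℂ)) := by
      rw [← integral_sub (hi₁ x hx) (hi₂ x hx)]
      simp only [hf, sub_div]
    simp only [hh]
    rw [e]
    simp only [hf]
    linear_combination e₁ - e₂
  have hz : ∀ x, h (Real.exp x) = 0 := by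
    refine eq_zero_of_homogeneous (F := fun v => h (Real.exp v)) h₀ h₁ hres (fun x => ?_)
      (fun x => ?_)
    · rw [← integrableOn_stieltjes_iff]
      exact (hi _ (Real.exp_pos x)).congr (stieltjes_congr hfh _)
    · rw [← integral_stieltjes, ← integral_congr_ae (stieltjes_congr hfh _)]
  filter_upwards [hfh, ae_restrict_mem measurableSet_Ioi] with x hx hx₀
  have hzx := hz (Real.log x)
  rw [Real.exp_log hx₀] at hzx
  rw [hzx] at hx
  exact sub_eq_zero.1 hx

lemma memE_of_integrableOn {f : ℝ → ℂ}
    (h : IntegrableOn (fun y : ℝ => f y / (((1 : ℝ) : ℂ) + (y : ℂ))) (Ioi 0)) : MemE f := by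
  simpa [MemE] using h

lemma two_mul_sin_mul_sin (x y : ℂ) :
    2 * Complex.sin x * Complex.sin y = Complex.cos (x - y) - Complex.cos (x + y) := by
  rw [Complex.cos_sub, Complex.cos_add]
  ring

/-- Resolvent kernel whose Laplace transform lives on `Re α < Re s < 1 - Re α`, for `Re α < 0`. -/
lemma exists_resolvent_neg {α lam : ℂ} (h₀ : α.re < 0) (h₁ : -(1 / 2) ≤ α.re)
    (hlam : lam = Complex.sin (Real.pi * α) / Real.pi) :
    ∃ r : ℝ → ℂ, (∀ c, 0 ≤ c → c ≤ 1 → Nice c r) ∧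
      ∀ v, r v = lam * stk v + lam * cv stk r v := by
  refine ⟨resk (2 * lam * 1 / Real.pi) (-α) (1 + α), fun c hc₀ hc₁ => ?_, fun v => ?_⟩
  · apply nice_resk <;> simp <;> linarith
  · refine resk_eq (c := 1 / 2) (α := α) (by norm_num) (by norm_num) ?_ ?_ ?_ ?_ hlam
      (fun s => ?_) v
    iterate 4
      simp
      linarith
    rw [two_mul_sin_mul_sin,
      show Real.pi * (-α + s) / 2 - Real.pi * (1 + α + s) / 2 = -(Real.pi * α + Real.pi / 2) by ring,
      show Real.pi * (-α + s) / 2 + Real.pi * (1 + α + s) / 2 = Real.pi * s + Real.pi / 2 by ring,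
      Complex.cos_neg, Complex.cos_add_pi_div_two, Complex.cos_add_pi_div_two]
    ring

/-- Resolvent kernel acting on functions that decay like small powers at infinity. -/
lemma exists_resolvent_left {α lam : ℂ} (h₀ : 0 < α.re) (h₁ : α.re ≤ 1 / 2)
    (hlam : lam = Complex.sin (Real.pi * α) / Real.pi) :
    ∃ r : ℝ → ℂ, (∀ c, 0 < c → c < α.re → Nice c r) ∧
      ∀ v, r v = lam * stk v + lam * cv stk r v := by
  refine ⟨resk (2 * lam * (-1) / Real.pi) (2 - α) (1 + α), fun c hc₀ hc₁ => ?_, fun v => ?_⟩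
  · apply nice_resk <;> simp <;> linarith
  · refine resk_eq (c := α.re / 2) (α := α) (by linarith) (by linarith) ?_ ?_ ?_ ?_ hlam
      (fun s => ?_) v
    iterate 4
      simp
      linarith
    rw [two_mul_sin_mul_sin,
      show Real.pi * (2 - α + s) / 2 - Real.pi * (1 + α + s) / 2 =
        Real.pi / 2 - Real.pi * α by ring,
      show Real.pi * (2 - α + s) / 2 + Real.pi * (1 + α + s) / 2 =
        Real.pi * s + Real.pi / 2 + Real.pi by ring,
      Complex.cos_pi_div_two_sub, Complex.cos_add_pi, Complex.cos_add_pi_div_two]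
    ring

/-- Resolvent kernel acting on functions with a strong singularity at the origin. -/
lemma exists_resolvent_right {α lam : ℂ} (h₀ : 0 < α.re) (h₁ : α.re ≤ 1 / 2)
    (hlam : lam = Complex.sin (Real.pi * α) / Real.pi) :
    ∃ r : ℝ → ℂ, (∀ c, 1 - α.re < c → c < 1 → Nice c r) ∧
      ∀ v, r v = lam * stk v + lam * cv stk r v := by
  refine ⟨resk (2 * lam * (-1) / Real.pi) (-α) (α - 1), fun c hc₀ hc₁ => ?_, fun v => ?_⟩
  · apply nice_resk <;> simp <;> linarith
  · refine resk_eq (c := 1 - α.re / 2) (α := α) (by linarith) (by linarith) ?_ ?_ ?_ ?_ hlam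
      (fun s => ?_) v
    iterate 4
      simp
      linarith
    rw [two_mul_sin_mul_sin,
      show Real.pi * (-α + s) / 2 - Real.pi * (α - 1 + s) / 2 = Real.pi / 2 - Real.pi * α by ring,
      show Real.pi * (-α + s) / 2 + Real.pi * (α - 1 + s) / 2 =
        Real.pi * s - Real.pi / 2 by ring,
      Complex.cos_pi_div_two_sub, Complex.cos_sub_pi_div_two]
    ring

/-- Corollary 2: let `0 < ε, η < 1`, `g ∈ B_{ε,η}`, `0 < |Re α| ≤ 1/2`,
`λ = sin(πα)/π`.
(a) If `Re α < 0` (i.e. `Re λ < 0`), the Stieltjes equation has a solution in `E`,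
unique up to a.e. equality, and every solution coincides a.e. with a member of `B_{ε,η}`.
(b) If `Re α > 0` (i.e. `Re λ > 0`), for every admissible pair `(ε̃, η̃)` as in Fig. 2
there exists a solution `f ∈ B_{ε̃,η̃}` satisfying the equation for all `x > 0`. -/
theorem stmt19 (ε η : ℝ) (hε1 : 0 < ε) (hε2 : ε < 1) (hη1 : 0 < η) (hη2 : η < 1)
    (g : ℝ → ℂ) (hg : MemB ε η g)
    (α : ℂ) (hα1 : 0 < |α.re|) (hα2 : |α.re| ≤ 1/2)
    (lam : ℂ) (hlam : lam = Complex.sin ((Real.pi : ℂ) * α) / (Real.pi : ℂ)) :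
    (α.re < 0 →
      (∃ f : ℝ → ℂ, MemE f ∧
        (∀ x : ℝ, 0 < x → IntegrableOn (fun y : ℝ => f y / ((x : ℂ) + (y : ℂ))) (Ioi 0)) ∧
        (∀ᵐ x ∂(volume.restrict (Ioi (0 : ℝ))),
          f x = g x + lam * ∫ y in Ioi (0 : ℝ), f y / ((x : ℂ) + (y : ℂ)))) ∧
      (∀ f₁ f₂ : ℝ → ℂ,
        (MemE f₁ ∧
          (∀ x : ℝ, 0 < x → IntegrableOn (fun y : ℝ => f₁ y / ((x : ℂ) + (y : ℂ))) (Ioi 0)) ∧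
          (∀ᵐ x ∂(volume.restrict (Ioi (0 : ℝ))),
            f₁ x = g x + lam * ∫ y in Ioi (0 : ℝ), f₁ y / ((x : ℂ) + (y : ℂ)))) →
        (MemE f₂ ∧
          (∀ x : ℝ, 0 < x → IntegrableOn (fun y : ℝ => f₂ y / ((x : ℂ) + (y : ℂ))) (Ioi 0)) →
          (∀ᵐ x ∂(volume.restrict (Ioi (0 : ℝ))),
            f₂ x = g x + lam * ∫ y in Ioi (0 : ℝ), f₂ y / ((x : ℂ) + (y : ℂ))) →
          f₁ =ᵐ[volume.restrict (Ioi (0 : ℝ))] f₂)) ∧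
      (∀ f : ℝ → ℂ, MemE f →
        (∀ x : ℝ, 0 < x → IntegrableOn (fun y : ℝ => f y / ((x : ℂ) + (y : ℂ))) (Ioi 0)) →
        (∀ᵐ x ∂(volume.restrict (Ioi (0 : ℝ))),
          f x = g x + lam * ∫ y in Ioi (0 : ℝ), f y / ((x : ℂ) + (y : ℂ))) →
        ∃ h : ℝ → ℂ, MemB ε η h ∧ f =ᵐ[volume.restrict (Ioi (0 : ℝ))] h)) ∧
    (0 < α.re →
      ∀ ε' η' : ℝ,
        ((ε < α.re ∧ ε' = ε) ∨ (¬ ε < α.re ∧ 0 < ε' ∧ ε' < α.re)) →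
        ((1 - α.re < η ∧ η' = η) ∨ (¬ 1 - α.re < η ∧ 1 - α.re < η' ∧ η' < 1)) →
        ∃ f : ℝ → ℂ, MemB ε' η' f ∧
          ∀ x : ℝ, 0 < x →
            IntegrableOn (fun y : ℝ => f y / ((x : ℂ) + (y : ℂ))) (Ioi 0) ∧
            f x = g x + lam * ∫ y in Ioi (0 : ℝ), f y / ((x : ℂ) + (y : ℂ))) := by
  refine ⟨fun hneg => ?_, fun hpos ε' η' hε' hη' => ?_⟩
  · rw [abs_of_neg hneg] at hα2
    obtain ⟨r, hr, hres⟩ := exists_resolvent_neg hneg (by linarith) hlam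
    have h₀ := hr 0 le_rfl zero_le_one
    have h₁ := hr 1 zero_le_one le_rfl
    obtain ⟨f, hf, hsol⟩ := hg.exists_solution hε1 hε2 le_rfl hη1 hη2 le_rfl
      (hr ε hε1.le hε2.le) (hr _ (le_min hε1.le hη1.le) ((min_le_left _ _).trans hε2.le))
      (hr η hη1.le hη2.le) (hr _ (le_max_of_le_left hε1.le) (max_le hε2.le hη2.le)) hres hres
    have hae : ∀ᵐ x ∂(volume.restrict (Ioi (0 : ℝ))),
        f x = g x + lam * ∫ y in Ioi (0 : ℝ), f y / ((x : ℂ) + (y : ℂ)) :=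
      (ae_restrict_mem measurableSet_Ioi).mono fun x hx => (hsol x hx).2
    refine ⟨⟨f, memE_of_integrableOn (hsol 1 one_pos).1, fun x hx => (hsol x hx).1, hae⟩, ?_, ?_⟩
    · rintro f₁ f₂ ⟨-, hi₁, hf₁⟩ ⟨-, hi₂⟩ hf₂
      exact ae_eq_of_stieltjes h₀ h₁ hres hi₁ hf₁ hi₂ hf₂
    · intro f' _ hi' hf'
      exact ⟨f, hf, ae_eq_of_stieltjes h₀ h₁ hres hi' hf' (fun x hx => (hsol x hx).1) hae⟩
  · rw [abs_of_pos hpos] at hα2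
    obtain ⟨r₁, hn₁, hr₁⟩ := exists_resolvent_left hpos hα2 hlam
    obtain ⟨r₂, hn₂, hr₂⟩ := exists_resolvent_right hpos hα2 hlam
    have hε₀ : 0 < ε' := by
      rcases hε' with ⟨-, rfl⟩ | ⟨-, h, -⟩ <;> assumption
    have hεα : ε' < α.re := by
      rcases hε' with ⟨h, rfl⟩ | ⟨-, -, h⟩ <;> assumption
    have hεε : ε' ≤ ε := by
      rcases hε' with ⟨-, rfl⟩ | ⟨h, -, -⟩ <;> linarith
    have hη₁ : η' < 1 := by
      rcases hη' with ⟨-, rfl⟩ | ⟨-, -, h⟩ <;> assumption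
    have hηα : 1 - α.re < η' := by
      rcases hη' with ⟨h, rfl⟩ | ⟨-, h, -⟩ <;> assumption
    have hηη : η ≤ η' := by
      rcases hη' with ⟨-, rfl⟩ | ⟨h, -, -⟩ <;> linarith
    have hle : ε' ≤ η' := by linarith
    refine hg.exists_solution hε₀ (by linarith) hεε (by linarith) hη₁ hηη
      (hn₁ _ hε₀ hεα) ?_ (hn₂ _ hηα hη₁) ?_ hr₁ hr₂
    · rw [min_eq_left hle]
      exact hn₁ _ hε₀ hεα
    · rw [max_eq_right hle]
      exact hn₂ _ hηα hη₁

end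
end
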